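/- arXiv:1902.07797 — 4 statements merged into one kernel-verified Lean document; each statement's English description precedes it below -/
import Mathlib

section
/- Let Q and P be concatenations on the same set X, with associated metrics d_Q and d_P. Then Q is almost subordinate to P if and only if the identity map Id_X : (X,d_Q) → (X,d_P) is Lipschitz continuous, i.e. there exists k > 0 with d_P(x,y) ≤ k·d_Q(x,y) for all x,y ∈ X. -/
open Set Pointwise MeasureTheory
open scoped Classical

/-- A `Q`-chain of length `k` from `x` to `y`: a sequence `Q_{i₁}, …, Q_{i_k}` of members of the
covering with `x ∈ Q_{i₁}`, `y ∈ Q_{i_k}` and consecutive members intersecting. -/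
def ChainExists {X I : Type*} (Q : I → Set X) (k : ℕ) (x y : X) : Prop :=
  ∃ (hk : 0 < k) (c : Fin k → I),
    x ∈ Q (c ⟨0, hk⟩) ∧ y ∈ Q (c ⟨k - 1, Nat.sub_lt hk Nat.one_pos⟩) ∧
      ∀ (l : ℕ) (h : l + 1 < k),
        (Q (c ⟨l, by omega⟩) ∩ Q (c ⟨l + 1, h⟩)).Nonempty

/-- An admissible covering: a family of nonempty sets covering `X` such that the number of
neighbours of each member is uniformly bounded. -/
def IsAdmissibleCovering {X I : Type*} (Q : I → Set X) : Prop :=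
  (∀ i, (Q i).Nonempty) ∧ (⋃ i, Q i) = Set.univ ∧
    ∃ N : ℕ, ∀ i, {j | (Q i ∩ Q j).Nonempty}.Finite ∧ {j | (Q i ∩ Q j).Nonempty}.ncard ≤ N

/-- A concatenation: an admissible covering in which any two points are joined by a chain. -/
def IsConcatenation {X I : Type*} (Q : I → Set X) : Prop :=
  IsAdmissibleCovering Q ∧ ∀ x y : X, ∃ k : ℕ, ChainExists Q k x y

/-- The associated metric `d_Q` of a covered space `(X, Q)`. -/
noncomputable def coveredDist {X I : Type*} (Q : I → Set X) (x y : X) : ℝ :=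
  if x = y then 0 else ((sInf {k : ℕ | ChainExists Q k x y} : ℕ) : ℝ)

/-- Quasi-isometric embedding between (abstract) metric spaces. -/
def IsQIEmbedding {X Z : Type*} (dX : X → X → ℝ) (dZ : Z → Z → ℝ) (f : X → Z) : Prop :=
  ∃ L C : ℝ, 0 < L ∧ 0 < C ∧ ∀ x y : X,
    (1 / L) * dX x y - C ≤ dZ (f x) (f y) ∧ dZ (f x) (f y) ≤ L * dX x y + C

/-- Quasi-isometry: a quasi-isometric embedding whose image is a net. -/
def IsQuasiIsometry {X Z : Type*} (dX : X → X → ℝ) (dZ : Z → Z → ℝ) (f : X → Z) : Prop :=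
  IsQIEmbedding dX dZ f ∧ ∃ M : ℝ, 0 < M ∧ ∀ z : Z, ∃ x : X, dZ z (f x) ≤ M

/-- The iterated neighbourhood `P_j^{k*}` of a member of a covering. -/
def starSet {X J : Type*} (P : J → Set X) (j : J) : ℕ → Set X
  | 0 => P j
  | k + 1 => ⋃ l ∈ {l | (P l ∩ starSet P j k).Nonempty}, P l

/-- `Q` is almost subordinate to `P`. -/
def AlmostSubordinate {X I J : Type*} (Q : I → Set X) (P : J → Set X) : Prop :=
  ∃ k : ℕ, ∀ i : I, ∃ j : J, Q i ⊆ starSet P j k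

/-- Two coverings of the same set are equivalent if each is almost subordinate to the other. -/
def EquivalentCoverings {X I J : Type*} (Q : I → Set X) (P : J → Set X) : Prop :=
  AlmostSubordinate Q P ∧ AlmostSubordinate P Q

/-- The word metric associated to a generating set `S` of a group. -/
noncomputable def wordDist {G : Type*} [Group G] (S : Set G) (g h : G) : ℝ :=
  ((sInf {n : ℕ | ∃ w : Fin n → G, (∀ i, w i ∈ S) ∧ g⁻¹ * h = (List.ofFn w).prod} : ℕ) : ℝ)

theorem chainExists_one {X I : Type*} {Q : I → Set X} {x y : X} :
    ChainExists Q 1 x y ↔ ∃ i, x ∈ Q i ∧ y ∈ Q i := by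
  constructor
  · rintro ⟨hk, c, hx, hy, -⟩
    exact ⟨_, hx, hy⟩
  · rintro ⟨i, hx, hy⟩
    exact ⟨Nat.one_pos, fun _ => i, hx, hy, fun l h => by omega⟩

theorem chainExists_succ {X I : Type*} {Q : I → Set X} {k : ℕ} (hk : 0 < k) {x y : X} :
    ChainExists Q (k + 1) x y ↔ ∃ z, ChainExists Q k x z ∧ ChainExists Q 1 z y := by
  simp only [chainExists_one]
  constructor
  · rintro ⟨hk', c, hx, hy, hc⟩
    obtain ⟨m, rfl⟩ : ∃ m, k = m + 1 := ⟨k - 1, by omega⟩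
    obtain ⟨z, hz, hz'⟩ := hc m (by omega)
    exact ⟨z, ⟨hk, fun l => c ⟨l, by omega⟩, hx, hz, fun l h => hc l (by omega)⟩, _, hz', hy⟩
  · rintro ⟨z, ⟨hk', c, hx, hz, hc⟩, i, hzi, hyi⟩
    refine ⟨k.succ_pos, fun l => if h : (l : ℕ) < k then c ⟨l, h⟩ else i, ?_, ?_, ?_⟩
    · simpa [hk] using hx
    · simpa using hyi
    · intro l h
      by_cases hl : l + 1 < k
      · simpa [hl, show l < k by omega] using hc l hl
      · obtain rfl : k = l + 1 := by omega
        simpa using ⟨z, hz, hzi⟩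

theorem ChainExists.pos {X I : Type*} {Q : I → Set X} {k : ℕ} {x y : X}
    (h : ChainExists Q k x y) : 0 < k := h.1

theorem ChainExists.trans {X I : Type*} {Q : I → Set X} {m n : ℕ} {x y z : X}
    (hxy : ChainExists Q m x y) (hyz : ChainExists Q n y z) : ChainExists Q (m + n) x z := by
  have hn : 1 ≤ n := hyz.pos
  induction n, hn using Nat.le_induction generalizing z with
  | base => exact (chainExists_succ hxy.pos).2 ⟨y, hxy, hyz⟩
  | succ n hn ih =>
    obtain ⟨w, hyw, hwz⟩ := (chainExists_succ hn).1 hyz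
    exact (chainExists_succ (k := m + n) (by omega)).2 ⟨w, ih hyw, hwz⟩

theorem ChainExists.symm {X I : Type*} {Q : I → Set X} {n : ℕ} {x y : X}
    (h : ChainExists Q n x y) : ChainExists Q n y x := by
  have hn : 1 ≤ n := h.pos
  induction n, hn using Nat.le_induction generalizing y with
  | base =>
    obtain ⟨i, hx, hy⟩ := chainExists_one.1 h
    exact chainExists_one.2 ⟨i, hy, hx⟩
  | succ n hn ih =>
    obtain ⟨z, hxz, hzy⟩ := (chainExists_succ hn).1 h
    obtain ⟨i, hz, hy⟩ := chainExists_one.1 hzy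
    rw [add_comm]
    exact (chainExists_one.2 ⟨i, hy, hz⟩).trans (ih hxz)

theorem ChainExists.mono {X I : Type*} {Q : I → Set X} (hQ : (⋃ i, Q i) = Set.univ) {m n : ℕ}
    (hmn : m ≤ n) {x y : X} (h : ChainExists Q m x y) : ChainExists Q n x y := by
  induction n, hmn using Nat.le_induction with
  | base => exact h
  | succ n hn ih =>
    obtain ⟨i, hi⟩ := Set.iUnion_eq_univ_iff.1 hQ y
    exact ih.trans (chainExists_one.2 ⟨i, hi, hi⟩)

/-- If the steps of a `Q`-chain can be replaced by `P`-chains of length `K`, then a `Q`-chain of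
length `n` can be replaced by a `P`-chain of length `n * K`. -/
theorem ChainExists.refine_steps {X I J : Type*} {Q : I → Set X} {P : J → Set X} {K : ℕ}
    (hK : ∀ x y, ChainExists Q 1 x y → ChainExists P K x y) {n : ℕ} {x y : X}
    (h : ChainExists Q n x y) : ChainExists P (n * K) x y := by
  have hn : 1 ≤ n := h.pos
  induction n, hn using Nat.le_induction generalizing y with
  | base => simpa using hK x y h
  | succ n hn ih =>
    obtain ⟨z, hxz, hzy⟩ := (chainExists_succ hn).1 h
    rw [Nat.succ_mul]
    exact (ih hxz).trans (hK z y hzy)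

theorem chainExists_of_mem_starSet {X J : Type*} {P : J → Set X} {j : J} {k : ℕ} {x y : X}
    (hx : x ∈ P j) (hy : y ∈ starSet P j k) : ChainExists P (k + 1) x y := by
  induction k generalizing y with
  | zero => exact chainExists_one.2 ⟨j, hx, hy⟩
  | succ k ih =>
    simp only [starSet, Set.mem_iUnion] at hy
    obtain ⟨l, ⟨z, hzl, hz⟩, hyl⟩ := hy
    exact (ih hz).trans (chainExists_one.2 ⟨l, hzl, hyl⟩)

theorem ChainExists.mem_starSet {X J : Type*} {P : J → Set X} {j : J} {k : ℕ} {x y : X}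
    (hx : x ∈ P j) (h : ChainExists P k x y) : y ∈ starSet P j k := by
  have step : ∀ {n z w}, z ∈ starSet P j n → ChainExists P 1 z w → w ∈ starSet P j (n + 1) := by
    intro n z w hz hzw
    obtain ⟨l, hzl, hwl⟩ := chainExists_one.1 hzw
    simp only [starSet, Set.mem_iUnion]
    exact ⟨l, ⟨z, hzl, hz⟩, hwl⟩
  have hk : 1 ≤ k := h.pos
  induction k, hk using Nat.le_induction generalizing y with
  | base => exact step (n := 0) hx h
  | succ k hk ih =>
    obtain ⟨z, hxz, hzy⟩ := (chainExists_succ hk).1 h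
    exact step (ih hxz) hzy

theorem coveredDist_le_of_chainExists {X I : Type*} {Q : I → Set X} {n : ℕ} {x y : X}
    (h : ChainExists Q n x y) : coveredDist Q x y ≤ n := by
  unfold coveredDist
  split_ifs
  · exact n.cast_nonneg
  · exact_mod_cast Nat.sInf_le h

theorem IsConcatenation.exists_chain_eq_coveredDist {X I : Type*} {Q : I → Set X}
    (hQ : IsConcatenation Q) {x y : X} (hxy : x ≠ y) :
    ∃ n : ℕ, ChainExists Q n x y ∧ coveredDist Q x y = n :=
  ⟨_, Nat.sInf_mem (hQ.2 x y), if_neg hxy⟩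

/-- Let `Q` and `P` be concatenations on the same set `X`. Then `Q` is almost
subordinate to `P` if and only if the identity map `Id_X : (X,d_Q) → (X,d_P)` is Lipschitz
continuous, i.e. there exists `k > 0` with `d_P(x,y) ≤ k·d_Q(x,y)` for all `x, y ∈ X`. -/
theorem statement1 {X I J : Type*} (Q : I → Set X) (P : J → Set X)
    (hQ : IsConcatenation Q) (hP : IsConcatenation P) :
    AlmostSubordinate Q P ↔
      ∃ k : ℝ, 0 < k ∧ ∀ x y : X, coveredDist P x y ≤ k * coveredDist Q x y := by
  constructor
  · rintro ⟨k, hk⟩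
    have step : ∀ x y, ChainExists Q 1 x y → ChainExists P ((k + 1) + (k + 1)) x y := by
      intro x y hxy
      obtain ⟨i, hx, hy⟩ := chainExists_one.1 hxy
      obtain ⟨j, hj⟩ := hk i
      obtain ⟨p, hp⟩ := hP.1.1 j
      exact (chainExists_of_mem_starSet hp (hj hx)).symm.trans
        (chainExists_of_mem_starSet hp (hj hy))
    refine ⟨((k + 1) + (k + 1) : ℕ), by positivity, fun x y => ?_⟩
    by_cases hxy : x = y
    · simp [coveredDist, hxy]
    · obtain ⟨n, hn, hd⟩ := hQ.exists_chain_eq_coveredDist hxy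
      rw [hd, mul_comm, ← Nat.cast_mul]
      exact coveredDist_le_of_chainExists (hn.refine_steps step)
  · rintro ⟨k, hk, hd⟩
    refine ⟨⌈k⌉₊, fun i => ?_⟩
    obtain ⟨x, hx⟩ := hQ.1.1 i
    obtain ⟨j, hj⟩ := Set.iUnion_eq_univ_iff.1 hP.1.2.1 x
    refine ⟨j, fun y hy => ChainExists.mem_starSet hj ?_⟩
    by_cases hxy : x = y
    · subst hxy
      exact (chainExists_one.2 ⟨j, hj, hj⟩).mono hP.1.2.1 (Nat.ceil_pos.2 hk)
    · obtain ⟨n, hn, hdn⟩ := hP.exists_chain_eq_coveredDist hxy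
      refine hn.mono hP.1.2.1 ?_
      have hQd : coveredDist Q x y ≤ 1 := by
        exact_mod_cast coveredDist_le_of_chainExists (chainExists_one.2 ⟨i, hx, hy⟩)
      have hnk : (n : ℝ) ≤ k := by
        rw [← hdn]
        exact (hd x y).trans (mul_le_of_le_one_right hk.le hQd)
      exact_mod_cast hnk.trans (Nat.le_ceil k)
end

section
/- For all n, m ≥ 1: there exists a quasi-isometry from (ℝⁿ, d_U) to (ℝᵐ, d_U) if and only if n = m; and there exists a quasi-isometric embedding from (ℝⁿ, d_U) to (ℝᵐ, d_U) if and only if n ≤ m. -/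
open Set Pointwise MeasureTheory
open scoped Classical

/-- The uniform covering of `ℝⁿ` by the integer translates of the unit cube. -/
def uniformCovering (n : ℕ) : (Fin n → ℤ) → Set (Fin n → ℝ) :=
  fun v => {x | ∀ i, (v i : ℝ) ≤ x i ∧ x i ≤ (v i : ℝ) + 1}

/-- The dyadic covering of `ℝⁿ` (with the Euclidean norm). -/
def dyadicCovering (n : ℕ) : ℕ → Set (EuclideanSpace ℝ (Fin n)) :=
  fun m => if m = 0 then {x | ‖x‖ ≤ 2}
           else {x | (2 : ℝ) ^ (m - 1) ≤ ‖x‖ ∧ ‖x‖ ≤ (2 : ℝ) ^ (m + 1)}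

/-- A chain of unit cubes of length `k` joins only points at sup-distance at most `k`. -/
theorem dist_le_of_chainExists {n k : ℕ} {x y : Fin n → ℝ}
    (h : ChainExists (uniformCovering n) k x y) : dist x y ≤ k := by
  obtain ⟨hk, c, hx, hy, hc⟩ := h
  have key : ∀ (l : ℕ) (hl : l < k) (z : Fin n → ℝ), z ∈ uniformCovering n (c ⟨l, hl⟩) →
      dist x z ≤ (l : ℝ) + 1 := by
    have cube : ∀ (v : Fin n → ℤ) (a b : Fin n → ℝ), a ∈ uniformCovering n v →
        b ∈ uniformCovering n v → dist a b ≤ 1 := by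
      intro v a b ha hb
      refine (dist_pi_le_iff zero_le_one).2 fun i => ?_
      rw [Real.dist_eq, abs_le]
      constructor <;> linarith [(ha i).1, (ha i).2, (hb i).1, (hb i).2]
    intro l
    induction l with
    | zero =>
      intro hl z hz
      simpa using cube _ x z hx hz
    | succ l ih =>
      intro hl z hz
      obtain ⟨p, hp, hp'⟩ := hc l hl
      have h1 := ih (by omega) p hp
      have h2 := cube _ p z hp' hz
      push_cast
      linarith [dist_triangle x p z]
  have h := key (k - 1) (by omega) y hy
  rwa [Nat.cast_sub hk, Nat.cast_one, sub_add_cancel] at h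

/-- Any two points are joined by a diagonal chain of unit cubes whose length is the sup-distance
up to an additive constant. -/
theorem exists_chainExists_le (n : ℕ) (x y : Fin n → ℝ) :
    ∃ k : ℕ, ChainExists (uniformCovering n) k x y ∧ (k : ℝ) ≤ dist x y + 3 := by
  set N : ℕ := ⌈dist x y + 1⌉₊ with hN
  have hNle : dist x y + 1 ≤ N := Nat.le_ceil _
  have hNlt : (N : ℝ) < dist x y + 1 + 1 := Nat.ceil_lt_add_one (by positivity)
  have hd : ∀ i, ⌊x i⌋ - ⌊y i⌋ ≤ N ∧ ⌊y i⌋ - ⌊x i⌋ ≤ N := by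
    intro i
    have h1 := (abs_le.1 ((Real.dist_eq _ _).symm.trans_le (dist_le_pi_dist x y i)))
    have a1 := Int.floor_le (x i)
    have a2 := Int.lt_floor_add_one (x i)
    have b1 := Int.floor_le (y i)
    have b2 := Int.lt_floor_add_one (y i)
    constructor
    · have : ((⌊x i⌋ - ⌊y i⌋ : ℤ) : ℝ) ≤ ((N : ℤ) : ℝ) := by push_cast; linarith [h1.2]
      exact_mod_cast this
    · have : ((⌊y i⌋ - ⌊x i⌋ : ℤ) : ℝ) ≤ ((N : ℤ) : ℝ) := by push_cast; linarith [h1.1]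
      exact_mod_cast this
  refine ⟨N + 1, ⟨N.succ_pos, fun l i => max (⌊x i⌋ - l) (min (⌊x i⌋ + l) ⌊y i⌋), ?_, ?_, ?_⟩, ?_⟩
  · intro i
    have : max (⌊x i⌋ - ((0 : ℕ) : ℤ)) (min (⌊x i⌋ + ((0 : ℕ) : ℤ)) ⌊y i⌋) = ⌊x i⌋ := by
      push_cast; omega
    simp only [this]
    exact ⟨Int.floor_le _, (Int.lt_floor_add_one _).le⟩
  · intro i
    have : max (⌊x i⌋ - ((N + 1 - 1 : ℕ) : ℤ)) (min (⌊x i⌋ + ((N + 1 - 1 : ℕ) : ℤ)) ⌊y i⌋) =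
        ⌊y i⌋ := by
      have := hd i
      rw [Nat.add_sub_cancel]; omega
    simp only [this]
    exact ⟨Int.floor_le _, (Int.lt_floor_add_one _).le⟩
  · intro l _
    have hmax : ∀ a b : ℤ, a ≤ b + 1 → b ≤ a + 1 →
        ((a : ℝ) ≤ (max a b : ℤ) ∧ ((max a b : ℤ) : ℝ) ≤ a + 1) ∧
          ((b : ℝ) ≤ (max a b : ℤ) ∧ ((max a b : ℤ) : ℝ) ≤ b + 1) := by
      intro a b h1 h2
      exact_mod_cast (by omega : (a ≤ max a b ∧ max a b ≤ a + 1) ∧ (b ≤ max a b ∧ max a b ≤ b + 1))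
    have hstep : ∀ i, _ := fun i => hmax (max (⌊x i⌋ - (l : ℤ)) (min (⌊x i⌋ + (l : ℤ)) ⌊y i⌋))
      (max (⌊x i⌋ - ((l + 1 : ℕ) : ℤ)) (min (⌊x i⌋ + ((l + 1 : ℕ) : ℤ)) ⌊y i⌋))
      (by push_cast; omega) (by push_cast; omega)
    exact ⟨_, fun i => (hstep i).1, fun i => (hstep i).2⟩
  · push_cast
    linarith

theorem dist_le_coveredDist (n : ℕ) (x y : Fin n → ℝ) :
    dist x y ≤ coveredDist (uniformCovering n) x y := by
  unfold coveredDist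
  split_ifs with h
  · simp [h]
  · obtain ⟨k, hk, -⟩ := exists_chainExists_le n x y
    exact dist_le_of_chainExists (Nat.sInf_mem (s := {k | ChainExists (uniformCovering n) k x y})
      ⟨k, hk⟩)

theorem coveredDist_le_dist_add (n : ℕ) (x y : Fin n → ℝ) :
    coveredDist (uniformCovering n) x y ≤ dist x y + 3 := by
  unfold coveredDist
  split_ifs with h
  · positivity
  · obtain ⟨k, hk, hle⟩ := exists_chainExists_le n x y
    exact (Nat.cast_le.2 (Nat.sInf_le hk)).trans hle

/-- Quasi-isometric embeddings for the covering metric are quasi-isometric embeddings for the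
sup-distance. -/
theorem isQIEmbedding_coveredDist_iff {n m : ℕ} {f : (Fin n → ℝ) → (Fin m → ℝ)} :
    IsQIEmbedding (coveredDist (uniformCovering n)) (coveredDist (uniformCovering m)) f ↔
      IsQIEmbedding dist dist f := by
  constructor
  · rintro ⟨L, C, hL, hC, h⟩
    refine ⟨L, C + L * 3 + 3, hL, by positivity, fun x y => ?_⟩
    have h1 := mul_le_mul_of_nonneg_left (dist_le_coveredDist n x y) (one_div_pos.2 hL).le
    have h2 := mul_le_mul_of_nonneg_left (coveredDist_le_dist_add n x y) hL.le
    constructor <;> linarith [h x y, dist_le_coveredDist m (f x) (f y),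
      coveredDist_le_dist_add m (f x) (f y)]
  · rintro ⟨L, C, hL, hC, h⟩
    have hL' := one_div_pos.2 hL
    refine ⟨L, C + 1 / L * 3 + 3, hL, by positivity, fun x y => ?_⟩
    have h1 := mul_le_mul_of_nonneg_left (coveredDist_le_dist_add n x y) hL'.le
    have h2 := mul_le_mul_of_nonneg_left (dist_le_coveredDist n x y) hL.le
    constructor <;> linarith [h x y, dist_le_coveredDist m (f x) (f y),
      coveredDist_le_dist_add m (f x) (f y)]

/-- If `k ^ n` is bounded by a constant multiple of `k ^ m` for all `k ≥ 1`, then `n ≤ m`. -/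
theorem le_of_forall_pow_le {n m A : ℕ} (h : ∀ k : ℕ, 1 ≤ k → k ^ n ≤ (A * k) ^ m) : n ≤ m := by
  by_contra! hlt
  have h1 := h (A ^ m + 1) (by omega)
  have h2 : (A ^ m + 1) ^ (m + 1) ≤ (A ^ m + 1) ^ n := Nat.pow_le_pow_right (by omega) hlt
  rw [mul_pow] at h1
  rw [pow_succ, mul_comm] at h2
  have := Nat.le_of_mul_le_mul_right (h2.trans h1) (by positivity)
  omega

/-- A quasi-isometric embedding between sup-normed spaces cannot lower the dimension, since it
maps a coarse lattice injectively to a lattice, with at most linear growth. -/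
theorem le_of_isQIEmbedding {n m : ℕ} {f : (Fin n → ℝ) → (Fin m → ℝ)}
    (hf : IsQIEmbedding dist dist f) : n ≤ m := by
  obtain ⟨L, C, hL, hC, h⟩ := hf
  set s : ℝ := L * (C + 2) with hs
  have hs0 : 0 < s := by positivity
  obtain ⟨A, hA⟩ := exists_nat_ge (L * s + C)
  refine le_of_forall_pow_le (A := 2 * A + 1) fun k hk => ?_
  have hk' : (1 : ℝ) ≤ k := by exact_mod_cast hk
  let p : (Fin n → Fin k) → Fin n → ℝ := fun v i => s * (v i : ℕ)
  let F : (Fin n → Fin k) → Fin m → ℤ := fun v i => ⌊f (p v) i - f 0 i⌋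
  have hmem : ∀ v ∈ (Finset.univ : Finset (Fin n → Fin k)),
      F v ∈ Fintype.piFinset fun _ : Fin m => Finset.Icc (-((A * k : ℕ) : ℤ)) ((A * k : ℕ) : ℤ) := by
    intro v _
    rw [Fintype.mem_piFinset]
    intro i
    have h1 : dist (p v) 0 ≤ s * k := by
      refine (dist_pi_le_iff (by positivity)).2 fun i => ?_
      have : ((v i : ℕ) : ℝ) ≤ k := by exact_mod_cast (v i).2.le
      simp only [p, Pi.zero_apply, Real.dist_eq, sub_zero]
      rw [abs_of_nonneg (by positivity)]
      gcongr
    have h2 : dist (f (p v)) (f 0) ≤ ((A * k : ℕ) : ℝ) := by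
      push_cast
      nlinarith [(h (p v) 0).2, mul_le_mul_of_nonneg_left h1 hL.le,
        mul_le_mul_of_nonneg_right hA (zero_le_one.trans hk')]
    have h3 := abs_le.1 ((Real.dist_eq _ _).symm.trans_le
      ((dist_le_pi_dist (f (p v)) (f 0) i).trans h2))
    rw [Finset.mem_Icc]
    constructor
    · rw [Int.le_floor]
      exact_mod_cast h3.1
    · have : ((F v i : ℤ) : ℝ) ≤ (((A * k : ℕ) : ℤ) : ℝ) := by
        exact_mod_cast (Int.floor_le _).trans h3.2
      exact_mod_cast this
  have hinj : Set.InjOn F (Finset.univ : Finset (Fin n → Fin k)) := by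
    intro v _ w _ hvw
    by_contra hne
    obtain ⟨i, hi⟩ := Function.ne_iff.1 hne
    have h1 : s ≤ dist (p v) (p w) := by
      refine le_trans ?_ (dist_le_pi_dist (p v) (p w) i)
      have hz : (1 : ℤ) ≤ |((v i : ℕ) : ℤ) - ((w i : ℕ) : ℤ)| := by
        refine Int.one_le_abs (sub_ne_zero.2 fun h => hi (Fin.ext ?_))
        exact_mod_cast h
      have hr : (1 : ℝ) ≤ |((v i : ℕ) : ℝ) - ((w i : ℕ) : ℝ)| := by exact_mod_cast hz
      simp only [p, Real.dist_eq]
      rw [← mul_sub, abs_mul, abs_of_pos hs0]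
      exact le_mul_of_one_le_right hs0.le hr
    have h2 : dist (f (p v)) (f (p w)) ≤ 1 := by
      refine (dist_pi_le_iff zero_le_one).2 fun j => ?_
      have h3 := Int.abs_sub_lt_one_of_floor_eq_floor (congrFun hvw j)
      rw [sub_sub_sub_cancel_right] at h3
      exact (Real.dist_eq _ _).trans_le h3.le
    have h3 := mul_le_mul_of_nonneg_left h1 (one_div_pos.2 hL).le
    have h4 : 1 / L * s = C + 2 := by rw [hs]; field_simp
    linarith [(h (p v) (p w)).1]
  have hcard := Finset.card_le_card_of_injOn F hmem hinj
  rw [Finset.card_univ, Fintype.card_pi_const, Fintype.card_fin, Fintype.card_piFinset_const,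
    Int.card_Icc] at hcard
  refine hcard.trans (Nat.pow_le_pow_left ?_ m)
  have : (2 * A + 1) * k = 2 * (A * k) + k := by ring
  rw [this]
  omega

/-- A map with coarsely dense image has a coarse inverse, which is a quasi-isometric embedding
whenever the map is. -/
theorem IsQIEmbedding.exists_coarse_inverse {X Z : Type*} [PseudoMetricSpace X]
    [PseudoMetricSpace Z] {f : X → Z} (hf : IsQIEmbedding dist dist f) {M : ℝ}
    (hM : ∀ z, ∃ x, dist z (f x) ≤ M) : ∃ g : Z → X, IsQIEmbedding dist dist g := by
  obtain ⟨L, C, hL, hC, h⟩ := hf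
  choose g hg using hM
  refine ⟨g, L, (C + 2 * |M|) * (L + 1 / L), hL, by positivity, fun z w => ?_⟩
  have h1 : |dist (f (g z)) (f (g w)) - dist z w| ≤ 2 * |M| := by
    have := hg z
    have := hg w
    have := le_abs_self M
    rw [abs_le]
    constructor
    · linarith [dist_triangle4 z (f (g z)) (f (g w)) w, dist_comm w (f (g w))]
    · linarith [dist_triangle4 (f (g z)) z w (f (g w)), dist_comm z (f (g z))]
  obtain ⟨h2, h3⟩ := abs_le.1 h1
  obtain ⟨h4, h5⟩ := h (g z) (g w)
  have hp : 0 < C + 2 * |M| := by positivity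
  have hL' : 0 < 1 / L := one_div_pos.2 hL
  have e : L * (1 / L) = 1 := by field_simp
  constructor
  · have h6 : dist z w - (C + 2 * |M|) ≤ L * dist (g z) (g w) := by linarith
    have h7 := mul_le_mul_of_nonneg_left h6 hL'.le
    have h8 : 1 / L * (L * dist (g z) (g w)) = dist (g z) (g w) := by field_simp
    nlinarith [mul_pos hp hL]
  · have h6 : 1 / L * dist (g z) (g w) ≤ dist z w + (C + 2 * |M|) := by linarith
    have h7 := mul_le_mul_of_nonneg_left h6 hL.le
    have h8 : L * (1 / L * dist (g z) (g w)) = dist (g z) (g w) := by field_simp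
    nlinarith [mul_pos hL' hp]

/-- Extending vectors by zero is an isometric, hence quasi-isometric, embedding. -/
theorem exists_isQIEmbedding_of_le {n m : ℕ} (h : n ≤ m) :
    ∃ f : (Fin n → ℝ) → (Fin m → ℝ), IsQIEmbedding dist dist f := by
  let f : (Fin n → ℝ) → (Fin m → ℝ) := fun x i => if hi : (i : ℕ) < n then x ⟨i, hi⟩ else 0
  have hf : ∀ x y, dist (f x) (f y) = dist x y := by
    intro x y
    apply le_antisymm
    · refine (dist_pi_le_iff dist_nonneg).2 fun i => ?_
      by_cases hi : (i : ℕ) < n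
      · simpa [f, hi] using dist_le_pi_dist x y ⟨i, hi⟩
      · simp [f, hi]
    · refine (dist_pi_le_iff dist_nonneg).2 fun i => ?_
      simpa [f] using dist_le_pi_dist (f x) (f y) (Fin.castLE h i)
  refine ⟨f, 1, 1, one_pos, one_pos, fun x y => ?_⟩
  rw [hf]
  constructor <;> linarith

/-- For all `n, m ≥ 1`: there exists a quasi-isometry from `(ℝⁿ, d_U)` to
`(ℝᵐ, d_U)` if and only if `n = m`; and there exists a quasi-isometric embedding from
`(ℝⁿ, d_U)` to `(ℝᵐ, d_U)` if and only if `n ≤ m`. -/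
theorem statement7 (n m : ℕ) (hn : 1 ≤ n) (hm : 1 ≤ m) :
    ((∃ f : (Fin n → ℝ) → (Fin m → ℝ),
        IsQuasiIsometry (coveredDist (uniformCovering n)) (coveredDist (uniformCovering m)) f)
      ↔ n = m) ∧
    ((∃ f : (Fin n → ℝ) → (Fin m → ℝ),
        IsQIEmbedding (coveredDist (uniformCovering n)) (coveredDist (uniformCovering m)) f)
      ↔ n ≤ m) := by
  constructor
  · constructor
    · rintro ⟨f, hf, M, -, hM⟩
      have hf' := isQIEmbedding_coveredDist_iff.1 hf
      obtain ⟨g, hg⟩ := hf'.exists_coarse_inverse fun z =>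
        (hM z).imp fun x hx => (dist_le_coveredDist m z (f x)).trans hx
      exact le_antisymm (le_of_isQIEmbedding hf') (le_of_isQIEmbedding hg)
    · rintro rfl
      refine ⟨id, ⟨1, 1, one_pos, one_pos, fun x y => ?_⟩, 1, one_pos, fun z => ⟨z, ?_⟩⟩
      · constructor <;> simp
      · simp [coveredDist]
  · constructor
    · rintro ⟨f, hf⟩
      exact le_of_isQIEmbedding (isQIEmbedding_coveredDist_iff.1 hf)
    · intro h
      exact (exists_isQIEmbedding_of_le h).imp fun f hf => isQIEmbedding_coveredDist_iff.2 hf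
end

section
/- For every n ≥ 1, the metric space (ℝⁿ, d_{B(ℝⁿ)}) is quasi-isometric to ℕ₀ = {0,1,2,…} with the metric d(a,b) = |a − b|. In particular, the metric spaces (ℝⁿ, d_{B(ℝⁿ)}) and (ℝᵐ, d_{B(ℝᵐ)}) are quasi-isometric for all n, m ≥ 1. -/
open Set Pointwise MeasureTheory
open scoped Classical

/-- The dyadic scale of a point: `⌊log₂ ‖x‖⌋` for `‖x‖ ≥ 1`, and `0` otherwise. -/
noncomputable def dyadicIndex {n : ℕ} (x : EuclideanSpace ℝ (Fin n)) : ℕ :=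
  Nat.log 2 ⌊‖x‖⌋₊

theorem le_dyadicIndex_iff {n k : ℕ} (hk : k ≠ 0) (x : EuclideanSpace ℝ (Fin n)) :
    k ≤ dyadicIndex x ↔ (2 : ℝ) ^ k ≤ ‖x‖ := by
  unfold dyadicIndex
  by_cases h : ⌊‖x‖⌋₊ = 0
  · have h1 : ‖x‖ < 1 := Nat.floor_eq_zero.mp h
    have h2 : (1 : ℝ) ≤ 2 ^ k := one_le_pow₀ (by norm_num)
    simp only [h, Nat.log_zero_right]
    constructor
    · omega
    · intro h3
      linarith
  · rw [Nat.le_log_iff_pow_le (by norm_num) h, Nat.le_floor_iff (norm_nonneg x)]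
    push_cast
    rfl

theorem dyadicIndex_eq {n k : ℕ} {x : EuclideanSpace ℝ (Fin n)} (hx : ‖x‖ = 2 ^ k) :
    dyadicIndex x = k := by
  unfold dyadicIndex
  have h : ‖x‖ = ((2 ^ k : ℕ) : ℝ) := by rw [hx]; push_cast; rfl
  rw [h, Nat.floor_natCast, Nat.log_pow (by norm_num)]

theorem mem_dyadicCovering_dyadicIndex {n : ℕ} (x : EuclideanSpace ℝ (Fin n)) :
    x ∈ dyadicCovering n (dyadicIndex x) := by
  have hlt : ‖x‖ < 2 ^ (dyadicIndex x + 1) := by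
    rw [← not_le, ← le_dyadicIndex_iff (by omega)]
    omega
  unfold dyadicCovering
  by_cases h : dyadicIndex x = 0
  · simp only [h, zero_add, pow_one] at hlt
    simpa [h] using hlt.le
  · simp only [h, if_false, mem_ofPred_eq]
    refine ⟨?_, hlt.le⟩
    calc (2 : ℝ) ^ (dyadicIndex x - 1) ≤ 2 ^ dyadicIndex x :=
          pow_le_pow_right₀ (by norm_num) (by omega)
      _ ≤ ‖x‖ := (le_dyadicIndex_iff h x).mp le_rfl

theorem dyadicIndex_bounds_of_mem {n k : ℕ} {x : EuclideanSpace ℝ (Fin n)}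
    (hx : x ∈ dyadicCovering n k) : dyadicIndex x ≤ k + 1 ∧ k ≤ dyadicIndex x + 1 := by
  have hle : ‖x‖ ≤ 2 ^ (k + 1) := by
    by_cases h : k = 0 <;> simp_all [dyadicCovering]
  constructor
  · by_contra! h
    have h1 := (le_dyadicIndex_iff (k := k + 2) (by omega) x).mp h
    have h2 : (2 : ℝ) ^ (k + 1) < 2 ^ (k + 2) := pow_lt_pow_right₀ (by norm_num) (by omega)
    linarith
  · by_cases h : k ≤ 1
    · omega
    · have h0 : k ≠ 0 := by omega
      simp only [dyadicCovering, h0, if_false, mem_ofPred_eq] at hx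
      have := (le_dyadicIndex_iff (k := k - 1) (by omega) x).mpr hx.1
      omega

theorem exists_norm_eq_two_pow {n : ℕ} (hn : 1 ≤ n) (k : ℕ) :
    ∃ x : EuclideanSpace ℝ (Fin n), ‖x‖ = 2 ^ k :=
  ⟨EuclideanSpace.single ⟨0, hn⟩ (2 ^ k), by simp⟩

theorem dyadicCovering_inter_succ_nonempty {n : ℕ} (hn : 1 ≤ n) (k : ℕ) :
    (dyadicCovering n k ∩ dyadicCovering n (k + 1)).Nonempty := by
  obtain ⟨x, hx⟩ := exists_norm_eq_two_pow hn (k + 1)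
  refine ⟨x, ?_, by simpa [dyadicIndex_eq hx] using mem_dyadicCovering_dyadicIndex x⟩
  unfold dyadicCovering
  split_ifs with h
  · simp [hx, h]
  · exact ⟨hx ▸ pow_le_pow_right₀ (by norm_num) (by omega), hx.le⟩

theorem index_close_of_inter_nonempty {n a b : ℕ}
    (h : (dyadicCovering n a ∩ dyadicCovering n b).Nonempty) : a ≤ b + 2 ∧ b ≤ a + 2 := by
  obtain ⟨x, ha, hb⟩ := h
  have := dyadicIndex_bounds_of_mem ha
  have := dyadicIndex_bounds_of_mem hb
  omega

theorem dyadicIndex_dist_le_of_chainExists {n k : ℕ} {x y : EuclideanSpace ℝ (Fin n)}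
    (h : ChainExists (dyadicCovering n) k x y) :
    |(dyadicIndex x : ℝ) - dyadicIndex y| ≤ 2 * k := by
  obtain ⟨hk, c, hx, hy, hc⟩ := h
  have key : ∀ (l : ℕ) (hl : l < k),
      c ⟨0, hk⟩ ≤ c ⟨l, hl⟩ + 2 * l ∧ c ⟨l, hl⟩ ≤ c ⟨0, hk⟩ + 2 * l := by
    intro l
    induction l with
    | zero => intro _; simp
    | succ l ih =>
      intro hl
      have := ih (by omega)
      have := index_close_of_inter_nonempty (hc l hl)
      omega
  have h1 := key (k - 1) (by omega)
  have h2 := dyadicIndex_bounds_of_mem hx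
  have h3 := dyadicIndex_bounds_of_mem hy
  have h4 : dyadicIndex x ≤ dyadicIndex y + 2 * k := by omega
  have h5 : dyadicIndex y ≤ dyadicIndex x + 2 * k := by omega
  have h4' : (dyadicIndex x : ℝ) ≤ dyadicIndex y + 2 * k := by exact_mod_cast h4
  have h5' : (dyadicIndex y : ℝ) ≤ dyadicIndex x + 2 * k := by exact_mod_cast h5
  rw [abs_le]
  constructor <;> linarith

theorem chainExists_dyadicCovering {n : ℕ} (hn : 1 ≤ n) (x y : EuclideanSpace ℝ (Fin n)) :
    ChainExists (dyadicCovering n) (Nat.dist (dyadicIndex x) (dyadicIndex y) + 1) x y := by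
  have hx := mem_dyadicCovering_dyadicIndex x
  have hy := mem_dyadicCovering_dyadicIndex y
  rcases le_total (dyadicIndex x) (dyadicIndex y) with h | h
  · rw [Nat.dist_eq_sub_of_le h]
    refine ⟨by omega, fun l => dyadicIndex x + l, by simpa using hx, ?_, fun l _ => ?_⟩
    · convert hy using 2
      simp only
      omega
    · exact dyadicCovering_inter_succ_nonempty hn _
  · rw [Nat.dist_eq_sub_of_le_right h]
    refine ⟨by omega, fun l => dyadicIndex x - l, by simpa using hx, ?_, fun l hl => ?_⟩
    · convert hy using 2
      simp only
      omega
    · have := dyadicCovering_inter_succ_nonempty hn (dyadicIndex x - (l + 1))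
      rw [inter_comm] at this
      convert this using 3
      simp only
      omega

theorem dyadicIndex_dist_le_coveredDist {n : ℕ} (hn : 1 ≤ n) (x y : EuclideanSpace ℝ (Fin n)) :
    |(dyadicIndex x : ℝ) - dyadicIndex y| ≤ 2 * coveredDist (dyadicCovering n) x y := by
  unfold coveredDist
  split_ifs with h
  · simp [h]
  · exact dyadicIndex_dist_le_of_chainExists
      (Nat.sInf_mem (s := {k | ChainExists (dyadicCovering n) k x y})
        ⟨_, chainExists_dyadicCovering hn x y⟩)

theorem coveredDist_le_dyadicIndex_dist {n : ℕ} (hn : 1 ≤ n) (x y : EuclideanSpace ℝ (Fin n)) :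
    coveredDist (dyadicCovering n) x y ≤ |(dyadicIndex x : ℝ) - dyadicIndex y| + 1 := by
  unfold coveredDist
  split_ifs with h
  · positivity
  · have h1 : sInf {k | ChainExists (dyadicCovering n) k x y} ≤
        Nat.dist (dyadicIndex x) (dyadicIndex y) + 1 :=
      Nat.sInf_le (chainExists_dyadicCovering hn x y)
    have h2 : ((Nat.dist (dyadicIndex x) (dyadicIndex y) : ℕ) : ℝ) =
        |(dyadicIndex x : ℝ) - dyadicIndex y| := by
      rcases le_total (dyadicIndex x) (dyadicIndex y) with h | h
      · rw [Nat.dist_eq_sub_of_le h, Nat.cast_sub h, abs_sub_comm,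
          abs_of_nonneg (sub_nonneg.mpr (by exact_mod_cast h))]
      · rw [Nat.dist_eq_sub_of_le_right h, Nat.cast_sub h,
          abs_of_nonneg (sub_nonneg.mpr (by exact_mod_cast h))]
    rw [← h2]
    exact_mod_cast h1

/-- For every `n ≥ 1`, the metric space `(ℝⁿ, d_{B(ℝⁿ)})` (dyadic covering) is
quasi-isometric to `ℕ₀` with the metric `d(a,b) = |a − b|`. In particular, `(ℝⁿ, d_{B(ℝⁿ)})`
and `(ℝᵐ, d_{B(ℝᵐ)})` are quasi-isometric for all `n, m ≥ 1`. -/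
theorem statement8 (n : ℕ) (hn : 1 ≤ n) :
    (∃ f : EuclideanSpace ℝ (Fin n) → ℕ,
      IsQuasiIsometry (coveredDist (dyadicCovering n))
        (fun a b : ℕ => |(a : ℝ) - (b : ℝ)|) f) ∧
    ∀ m : ℕ, 1 ≤ m →
      ∃ g : EuclideanSpace ℝ (Fin n) → EuclideanSpace ℝ (Fin m),
        IsQuasiIsometry (coveredDist (dyadicCovering n)) (coveredDist (dyadicCovering m)) g := by
  refine ⟨⟨dyadicIndex, ⟨2, 1, by norm_num, by norm_num, fun x y => ?_⟩, 1, one_pos,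
    fun k => ?_⟩, fun m hm => ?_⟩
  · have h1 := dyadicIndex_dist_le_coveredDist hn x y
    have h2 := coveredDist_le_dyadicIndex_dist hn x y
    have h3 := abs_nonneg ((dyadicIndex x : ℝ) - dyadicIndex y)
    constructor <;> linarith
  · obtain ⟨x, hx⟩ := exists_norm_eq_two_pow hn k
    exact ⟨x, by simp [dyadicIndex_eq hx]⟩
  · choose p hp using exists_norm_eq_two_pow hm
    refine ⟨fun x => p (dyadicIndex x), ⟨2, 1, by norm_num, by norm_num, fun x y => ?_⟩, 1,
      one_pos, fun z => ?_⟩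
    · have h1 := dyadicIndex_dist_le_coveredDist hn x y
      have h2 := coveredDist_le_dyadicIndex_dist hn x y
      have h3 := dyadicIndex_dist_le_coveredDist hm (p (dyadicIndex x)) (p (dyadicIndex y))
      have h4 := coveredDist_le_dyadicIndex_dist hm (p (dyadicIndex x)) (p (dyadicIndex y))
      rw [dyadicIndex_eq (hp _), dyadicIndex_eq (hp _)] at h3 h4
      constructor <;> linarith
    · obtain ⟨x, hx⟩ := exists_norm_eq_two_pow hn (dyadicIndex z)
      refine ⟨x, (coveredDist_le_dyadicIndex_dist hm _ _).trans ?_⟩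
      simp [dyadicIndex_eq (hp _), dyadicIndex_eq hx]
end

section
/- For all n, m, k ≥ 1: if n ≠ m then (ℝ^{2n+1}, d_{P_n}) is not quasi-isometric to (ℝ^{2m+1}, d_{P_m}); and for every k, (ℝ^{2n+1}, d_{P_n}) is not quasi-isometric to (ℝᵏ, d_U). In particular the Heisenberg covering P_1 on ℝ³ is not equivalent to the uniform covering U on ℝ³. -/
open Set Pointwise MeasureTheory
open scoped Classical

/-- The underlying space `ℝ^{2n+1} = ℝⁿ × ℝⁿ × ℝ` of the Heisenberg group. -/
abbrev HeisReal (n : ℕ) : Type := (Fin n → ℝ) × (Fin n → ℝ) × ℝ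

/-- The integer points `ℤ^{2n+1}`, underlying the discrete Heisenberg group. -/
abbrev HeisInt (n : ℕ) : Type := (Fin n → ℤ) × (Fin n → ℤ) × ℤ

/-- The Heisenberg product `(a,b,c) * (a',b',c') = (a+a', b+b', c+c'+a·b')` on `ℝ^{2n+1}`. -/
def heisMul {n : ℕ} (p q : HeisReal n) : HeisReal n :=
  (p.1 + q.1, p.2.1 + q.2.1, p.2.2 + q.2.2 + ∑ i, p.1 i * q.2.1 i)

/-- The Heisenberg product on `ℤ^{2n+1}`, making it the discrete Heisenberg group
`ℍ_{2n+1}(ℤ)`. -/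
def heisMulZ {n : ℕ} (p q : HeisInt n) : HeisInt n :=
  (p.1 + q.1, p.2.1 + q.2.1, p.2.2 + q.2.2 + ∑ i, p.1 i * q.2.1 i)

/-- The inclusion `ℤ^{2n+1} ⊆ ℝ^{2n+1}`. -/
def heisEmbed {n : ℕ} (γ : HeisInt n) : HeisReal n :=
  (fun i => (γ.1 i : ℝ), fun i => (γ.2.1 i : ℝ), (γ.2.2 : ℝ))

/-- The unit cube `[0,1]^{2n+1}` in `ℝ^{2n+1}`. -/
def heisCube (n : ℕ) : Set (HeisReal n) :=
  {p | (∀ i, p.1 i ∈ Set.Icc (0 : ℝ) 1) ∧ (∀ i, p.2.1 i ∈ Set.Icc (0 : ℝ) 1) ∧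
    p.2.2 ∈ Set.Icc (0 : ℝ) 1}

/-- The Heisenberg covering `P_n = (γ * [0,1]^{2n+1})_{γ ∈ ℤ^{2n+1}}` of `ℝ^{2n+1}`. -/
def heisCover (n : ℕ) : HeisInt n → Set (HeisReal n) :=
  fun γ => (fun x => heisMul (heisEmbed γ) x) '' heisCube n

/-- The uniform covering of `ℝ^{2n+1}` by additive integer translates of the unit cube. -/
def uniformCoverH (n : ℕ) : HeisInt n → Set (HeisReal n) :=
  fun γ => (fun x => heisEmbed γ + x) '' heisCube n

section Isometries

variable {V : Type*} [NormedAddCommGroup V] [InnerProductSpace ℝ V]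

lemma norm_pow_apply {X : Module.End ℝ V} (hX : ∀ v, ‖X v‖ = ‖v‖) (a : ℕ) (v : V) :
    ‖(X ^ a) v‖ = ‖v‖ := by
  induction a with
  | zero => simp
  | succ a ih => rw [pow_succ', Module.End.mul_apply, hX, ih]

lemma norm_pow_apply_sub_le {X : Module.End ℝ V} (hX : ∀ v, ‖X v‖ = ‖v‖) (a : ℕ) (v : V) :
    ‖(X ^ a) v - v‖ ≤ a * ‖X v - v‖ := by
  induction a with
  | zero => simp
  | succ a ih =>
    have h : (X ^ (a + 1)) v - v = (X ^ a) (X v - v) + ((X ^ a) v - v) := by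
      rw [pow_succ, Module.End.mul_apply, map_sub]; abel
    calc _ ≤ ‖(X ^ a) (X v - v)‖ + ‖(X ^ a) v - v‖ := h ▸ norm_add_le _ _
      _ ≤ ‖X v - v‖ + a * ‖X v - v‖ := by rw [norm_pow_apply hX]; gcongr
      _ = _ := by push_cast; ring

/-- Second-order Taylor estimate for the powers of an isometry. -/
lemma norm_pow_apply_sub_smul_le {W : Module.End ℝ V} (hW : ∀ v, ‖W v‖ = ‖v‖) (m : ℕ) (v : V) :
    ‖(W ^ m) v - v - (m : ℝ) • (W v - v)‖ ≤ (m : ℝ) ^ 2 * ‖W (W v - v) - (W v - v)‖ := by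
  induction m with
  | zero => simp
  | succ m ih =>
    have h : (W ^ (m + 1)) v - v - ((m + 1 : ℕ) : ℝ) • (W v - v) =
        ((W ^ m) v - v - (m : ℝ) • (W v - v)) + ((W ^ m) (W v - v) - (W v - v)) := by
      rw [pow_succ, Module.End.mul_apply, map_sub]; push_cast; module
    have h2 := norm_pow_apply_sub_le hW m (W v - v)
    have h3 := norm_add_le ((W ^ m) v - v - (m : ℝ) • (W v - v)) ((W ^ m) (W v - v) - (W v - v))
    rw [h]
    push_cast
    have := norm_nonneg (W (W v - v) - (W v - v))
    have := m.cast_nonneg (α := ℝ)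
    nlinarith

lemma norm_half_add_sq {T : Module.End ℝ V} (hT : ∀ v, ‖T v‖ = ‖v‖) (w : V) :
    ‖(1 / 2 : ℝ) • (w + T w)‖ ^ 2 = ‖w‖ ^ 2 - ‖T w - w‖ ^ 2 / 4 := by
  have h := parallelogram_law_with_norm ℝ w (T w)
  rw [hT, ← norm_neg (w - T w), neg_sub] at h
  rw [norm_smul]
  norm_num
  nlinarith

lemma norm_half_add_le {T : Module.End ℝ V} (hT : ∀ v, ‖T v‖ = ‖v‖) (w : V) :
    ‖(1 / 2 : ℝ) • (w + T w)‖ ≤ ‖w‖ := by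
  refine le_of_sq_le_sq ?_ (norm_nonneg _)
  rw [norm_half_add_sq hT]
  nlinarith [sq_nonneg ‖T w - w‖]

lemma norm_half_add_sub_le {T : Module.End ℝ V} (w v : V) (hT : ∀ v, ‖T v‖ = ‖v‖) :
    ‖(1 / 2 : ℝ) • (w + T w) - v‖ ≤ ‖w - v‖ + ‖T v - v‖ / 2 := by
  have h : (1 / 2 : ℝ) • (w + T w) - v =
      (1 / 2 : ℝ) • ((w - v) + T (w - v)) + (1 / 2 : ℝ) • (T v - v) := by
    rw [map_sub]; module
  rw [h]
  refine (norm_add_le _ _).trans (add_le_add (norm_half_add_le hT _) ?_)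
  rw [norm_smul]
  norm_num
  linarith

/-- The average of the first `4 ^ j` powers of `Z`. -/
noncomputable def powAverage (Z : Module.End ℝ V) : ℕ → Module.End ℝ V
  | 0 => 1
  | j + 1 => (1 / 2 : ℝ) • (1 + (Z ^ (2 ^ j * 2 ^ j)) ^ 2) *
      ((1 / 2 : ℝ) • (1 + Z ^ (2 ^ j * 2 ^ j)) * powAverage Z j)

lemma powAverage_succ_apply (Z : Module.End ℝ V) (j : ℕ) (v : V) :
    powAverage Z (j + 1) v =
      (1 / 2 : ℝ) • ((1 / 2 : ℝ) • (powAverage Z j v + (Z ^ (2 ^ j * 2 ^ j)) (powAverage Z j v)) +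
        ((Z ^ (2 ^ j * 2 ^ j)) ^ 2)
          ((1 / 2 : ℝ) • (powAverage Z j v + (Z ^ (2 ^ j * 2 ^ j)) (powAverage Z j v)))) := by
  simp [powAverage, Module.End.mul_apply]

lemma Commute.powAverage {Z X : Module.End ℝ V} (h : Commute Z X) (j : ℕ) :
    Commute (powAverage Z j) X := by
  induction j with
  | zero => exact Commute.one_left X
  | succ j ih =>
    have h1 : Commute (Z ^ (2 ^ j * 2 ^ j)) X := h.pow_left _
    exact (((Commute.one_left X).add_left (h1.pow_left 2)).smul_left _).mul_left
      ((((Commute.one_left X).add_left h1).smul_left _).mul_left ih)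

lemma norm_powAverage_sq_add_sum_le {Z : Module.End ℝ V} (hZ : ∀ v, ‖Z v‖ = ‖v‖) (J : ℕ) (v : V) :
    ‖powAverage Z J v‖ ^ 2 + ∑ j ∈ Finset.range J,
      ‖(Z ^ (2 ^ j * 2 ^ j)) (powAverage Z j v) - powAverage Z j v‖ ^ 2 / 4 ≤ ‖v‖ ^ 2 := by
  induction J with
  | zero => simp [powAverage]
  | succ J ih =>
    have hT := norm_pow_apply hZ (2 ^ J * 2 ^ J)
    rw [Finset.sum_range_succ, powAverage_succ_apply]
    have h1 := norm_half_add_le (norm_pow_apply hT 2)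
      ((1 / 2 : ℝ) • (powAverage Z J v + (Z ^ (2 ^ J * 2 ^ J)) (powAverage Z J v)))
    have h2 := norm_half_add_sq hT (powAverage Z J v)
    have h3 := pow_le_pow_left₀ (norm_nonneg _) h1 2
    linarith

/-- The relations of the discrete Heisenberg group, satisfied by linear isometries. -/
structure HeisIsometries (X Y Z : Module.End ℝ V) : Prop where
  norm_x : ∀ v, ‖X v‖ = ‖v‖
  norm_y : ∀ v, ‖Y v‖ = ‖v‖
  norm_z : ∀ v, ‖Z v‖ = ‖v‖
  comm_x : Commute Z X
  comm_y : Commute Z Y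
  rel : X * Y = Z * (Y * X)

namespace HeisIsometries

variable {X Y Z : Module.End ℝ V}

lemma pow_mul_pow (h : HeisIsometries X Y Z) (a b : ℕ) :
    X ^ a * Y ^ b = Z ^ (a * b) * (Y ^ b * X ^ a) := by
  have h1 : ∀ a : ℕ, X ^ a * Y = Z ^ a * (Y * X ^ a) := by
    intro a
    induction a with
    | zero => simp
    | succ a ih =>
      have hc : X * Z ^ a = Z ^ a * X := ((h.comm_x.pow_left a).eq).symm
      calc X ^ (a + 1) * Y = X * (X ^ a * Y) := by rw [pow_succ', mul_assoc]
        _ = (X * Z ^ a) * (Y * X ^ a) := by rw [ih, mul_assoc]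
        _ = Z ^ a * ((X * Y) * X ^ a) := by rw [hc]; simp only [mul_assoc]
        _ = Z ^ (a + 1) * (Y * X ^ (a + 1)) := by
          rw [h.rel, pow_succ Z, pow_succ' X]; simp only [mul_assoc]
  induction b with
  | zero => simp
  | succ b ih =>
    have hc : Y ^ b * Z ^ a = Z ^ a * Y ^ b := ((h.comm_y.pow_pow a b).eq).symm
    calc X ^ a * Y ^ (b + 1) = (X ^ a * Y ^ b) * Y := by rw [pow_succ, mul_assoc]
      _ = Z ^ (a * b) * (Y ^ b * (X ^ a * Y)) := by rw [ih]; simp only [mul_assoc]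
      _ = Z ^ (a * b) * ((Y ^ b * Z ^ a) * (Y * X ^ a)) := by rw [h1]; simp only [mul_assoc]
      _ = Z ^ (a * (b + 1)) * (Y ^ (b + 1) * X ^ a) := by
        rw [hc, mul_add, mul_one, pow_add, pow_succ Y]; simp only [mul_assoc]

lemma norm_z_pow_sub_le (h : HeisIsometries X Y Z) (a b : ℕ) (v : V) :
    ‖(Z ^ (a * b)) v - v‖ ≤ 2 * (a * ‖X v - v‖ + b * ‖Y v - v‖) := by
  have hX := norm_pow_apply h.norm_x a
  have hY := norm_pow_apply h.norm_y b
  have hc : Commute (Z ^ (a * b)) (Y ^ b * X ^ a) :=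
    (h.comm_y.pow_pow _ _).mul_right (h.comm_x.pow_pow _ _)
  have e : (X ^ a) ((Y ^ b) v) - (Y ^ b) ((X ^ a) v) = (Y ^ b) ((X ^ a) ((Z ^ (a * b)) v - v)) := by
    have := LinearMap.congr_fun ((h.pow_mul_pow a b).trans hc.eq) v
    simp only [Module.End.mul_apply] at this
    rw [this, map_sub, map_sub]
  have e1 : ‖(X ^ a) ((Y ^ b) v) - (X ^ a) v‖ ≤ b * ‖Y v - v‖ := by
    rw [← map_sub, hX]; exact norm_pow_apply_sub_le h.norm_y b v
  have e2 : ‖(Y ^ b) ((X ^ a) v) - (Y ^ b) v‖ ≤ a * ‖X v - v‖ := by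
    rw [← map_sub, hY]; exact norm_pow_apply_sub_le h.norm_x a v
  have e3 := norm_pow_apply_sub_le h.norm_x a v
  have e4 := norm_pow_apply_sub_le h.norm_y b v
  rw [← hX, ← hY, ← e]
  have : (X ^ a) ((Y ^ b) v) - (Y ^ b) ((X ^ a) v) =
    (((X ^ a) ((Y ^ b) v) - (X ^ a) v) + ((X ^ a) v - v)) -
      (((Y ^ b) ((X ^ a) v) - (Y ^ b) v) + ((Y ^ b) v - v)) := by abel
  rw [this]
  refine (norm_sub_le _ _).trans ?_
  linarith [norm_add_le ((X ^ a) ((Y ^ b) v) - (X ^ a) v) ((X ^ a) v - v),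
    norm_add_le ((Y ^ b) ((X ^ a) v) - (Y ^ b) v) ((Y ^ b) v - v)]

lemma norm_z_sq_pow_sub_le (h : HeisIsometries X Y Z) (N : ℕ) (v : V) :
    ‖(Z ^ (N * N)) v - v‖ ≤ 2 * N * (‖X v - v‖ + ‖Y v - v‖) :=
  (h.norm_z_pow_sub_le N N v).trans (le_of_eq (by ring))

lemma norm_powAverage_sub_le (h : HeisIsometries X Y Z) (j : ℕ) (v : V) :
    ‖powAverage Z j v - v‖ ≤ 3 * 2 ^ j * (‖X v - v‖ + ‖Y v - v‖) := by
  induction j with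
  | zero => simp [powAverage]; positivity
  | succ j ih =>
    have hT := norm_pow_apply h.norm_z (2 ^ j * 2 ^ j)
    have h1 := norm_half_add_sub_le (powAverage Z j v) v hT
    have h2 := norm_half_add_sub_le ((1 / 2 : ℝ) • (powAverage Z j v +
      (Z ^ (2 ^ j * 2 ^ j)) (powAverage Z j v))) v (norm_pow_apply hT 2)
    have h3 := norm_pow_apply_sub_le hT 2 v
    have h4 := h.norm_z_sq_pow_sub_le (2 ^ j) v
    push_cast at h3 h4
    rw [powAverage_succ_apply, pow_succ (2 : ℝ)]
    linarith

/-- Along some scale `N`, the central element `Z ^ (N ^ 2)` moves `v` by much less than `N` times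
the displacement of `v` under the generators. -/
theorem exists_scale (h : HeisIsometries X Y Z) (v : V) (p : ℕ) (hp : 1 ≤ p) :
    ∃ j < p ^ 18, ‖(Z ^ ((p ^ 3 * 2 ^ j) * (p ^ 3 * 2 ^ j))) v - v‖ ≤
      20 / p * (p ^ 3 * 2 ^ j) * (‖X v - v‖ + ‖Y v - v‖) := by
  set α := ‖X v - v‖ + ‖Y v - v‖ with hα
  have hα0 : 0 ≤ α := by positivity
  have hp0 : (0 : ℝ) < p := by exact_mod_cast hp
  have hp1 : (1 : ℝ) ≤ p := by exact_mod_cast hp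
  set η : ℕ → V := fun j => (Z ^ (2 ^ j * 2 ^ j)) (powAverage Z j v) - powAverage Z j v with hη
  have key : ∀ U : Module.End ℝ V, Commute Z U → ∀ j, U (η j) - η j =
      (Z ^ (2 ^ j * 2 ^ j)) (powAverage Z j (U v - v)) - powAverage Z j (U v - v) := by
    intro U hU j
    have e1 := LinearMap.congr_fun (hU.powAverage j).eq v
    have e2 := LinearMap.congr_fun (hU.pow_left (2 ^ j * 2 ^ j)).eq (powAverage Z j v)
    simp only [Module.End.mul_apply] at e1 e2
    simp only [hη, map_sub, e1, e2]
    abel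
  obtain ⟨j, hj, hjle⟩ : ∃ j ∈ Finset.range (p ^ 18),
      ‖X (η j) - η j‖ ^ 2 + ‖Y (η j) - η j‖ ^ 2 ≤ 4 * α ^ 2 / (p ^ 18 : ℕ) := by
    apply Finset.exists_le_of_sum_le
    · exact ⟨0, Finset.mem_range.2 (by positivity)⟩
    · have hx := norm_powAverage_sq_add_sum_le h.norm_z (p ^ 18) (X v - v)
      have hy := norm_powAverage_sq_add_sum_le h.norm_z (p ^ 18) (Y v - v)
      rw [← Finset.sum_div] at hx hy
      simp only [← key X h.comm_x] at hx
      simp only [← key Y h.comm_y] at hy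
      rw [Finset.sum_const, Finset.card_range, Finset.sum_add_distrib, nsmul_eq_mul,
        mul_div_cancel₀ _ (by positivity)]
      nlinarith [norm_nonneg (X v - v), norm_nonneg (Y v - v),
        sq_nonneg ‖powAverage Z (p ^ 18) (X v - v)‖, sq_nonneg ‖powAverage Z (p ^ 18) (Y v - v)‖]
  refine ⟨j, Finset.mem_range.1 hj, ?_⟩
  set N := p ^ 3 * 2 ^ j with hN
  have hNr : (N : ℝ) = p ^ 3 * 2 ^ j := by push_cast [hN]; ring
  have hN0 : (0 : ℝ) < N := by rw [hNr]; positivity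
  rw [← hNr]
  have hβ : ‖X (η j) - η j‖ + ‖Y (η j) - η j‖ ≤ 3 * α / p ^ 9 := by
    apply le_of_sq_le_sq _ (by positivity)
    have e : 4 * α ^ 2 / (p ^ 18 : ℕ) = 4 * (α / p ^ 9) ^ 2 := by push_cast; field_simp
    have e' : (3 * α / p ^ 9) ^ 2 = 9 * (α / p ^ 9) ^ 2 := by field_simp; ring
    rw [e] at hjle
    rw [e']
    nlinarith [sq_nonneg (‖X (η j) - η j‖ - ‖Y (η j) - η j‖), sq_nonneg (α / p ^ 9)]
  set W := Z ^ (N * N) with hWdef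
  have hW : ∀ v, ‖W v‖ = ‖v‖ := norm_pow_apply h.norm_z _
  have hWη : ‖W (η j) - η j‖ ≤ 2 * N * (3 * α / p ^ 9) :=
    (h.norm_z_sq_pow_sub_le N (η j)).trans (by gcongr)
  have hT := norm_pow_apply h.norm_z (2 ^ j * 2 ^ j)
  have hWT : W = (Z ^ (2 ^ j * 2 ^ j)) ^ (p ^ 6) := by
    rw [← pow_mul, hWdef]; congr 1; rw [hN]; ring
  set m := powAverage Z j v with hm
  have hsecond : ‖W (W m - m) - (W m - m)‖ ≤ p ^ 6 * (2 * N * (3 * α / p ^ 9)) := by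
    have h1 := norm_pow_apply_sub_le hT (p ^ 6) (W m - m)
    rw [← hWT] at h1
    have e : (Z ^ (2 ^ j * 2 ^ j)) (W m - m) - (W m - m) = W (η j) - η j := by
      have := LinearMap.congr_fun (((Commute.refl Z).pow_pow (2 ^ j * 2 ^ j) (N * N)).eq) m
      simp only [Module.End.mul_apply, ← hWdef] at this
      simp only [hη, map_sub, this, ← hm]
      abel
    rw [e] at h1
    refine h1.trans ?_
    push_cast
    gcongr
  have hdiff : ∀ u : V, ‖W (W u - u) - (W u - u)‖ ≤ 4 * ‖u‖ := by
    intro u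
    have h1 := norm_sub_le (W (W u - u)) (W u - u)
    have h2 := norm_sub_le (W u) u
    rw [hW] at h1 h2
    linarith
  have hsecond' : ‖W (W v - v) - (W v - v)‖ ≤ N * α * (18 / p ^ 3) := by
    have e : W (W v - v) - (W v - v) =
        (W (W m - m) - (W m - m)) - (W (W (m - v) - (m - v)) - (W (m - v) - (m - v))) := by
      simp only [map_sub]; abel
    have h1 := hdiff (m - v)
    have h2 := h.norm_powAverage_sub_le j v
    have h3 : (2 : ℝ) ^ j = N / p ^ 3 := by rw [hNr]; field_simp
    rw [← hα, h3] at h2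
    rw [e]
    refine (norm_sub_le _ _).trans ?_
    have e2 : (p : ℝ) ^ 6 * (2 * N * (3 * α / p ^ 9)) = N * α * (6 / p ^ 3) := by field_simp; ring
    have e3 : 3 * (N / (p : ℝ) ^ 3) * α = N * α * (3 / p ^ 3) := by field_simp
    rw [e2] at hsecond
    rw [e3] at h2
    have e4 : N * α * (18 / (p : ℝ) ^ 3) = N * α * (6 / p ^ 3) + 4 * (N * α * (3 / p ^ 3)) := by ring
    linarith
  have htaylor := norm_pow_apply_sub_smul_le hW (p * p) v
  have hWp : W ^ (p * p) = Z ^ ((p * N) * (p * N)) := by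
    rw [hWdef, ← pow_mul]; congr 1; ring
  have hbig := h.norm_z_sq_pow_sub_le (p * N) v
  rw [← hWp, ← hα] at hbig
  have htri := norm_sub_le ((W ^ (p * p)) v - v)
    ((W ^ (p * p)) v - v - ((p * p : ℕ) : ℝ) • (W v - v))
  rw [sub_sub_cancel, norm_smul, Real.norm_natCast] at htri
  push_cast at htri hbig htaylor
  have hmul : (p : ℝ) * p * ‖W v - v‖ ≤ p * p * (20 / p * N * α) := by
    have e1 : (p : ℝ) * p * (20 / p * N * α) =
        2 * (p * N) * α + (p * p) ^ 2 * (N * α * (18 / p ^ 3)) := by field_simp; ring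
    rw [e1]
    refine htri.trans (add_le_add hbig (htaylor.trans ?_))
    gcongr
  exact le_of_mul_le_mul_left hmul (by positivity)

end HeisIsometries

end Isometries

section Translations

variable {ι E : Type*} [NormedAddCommGroup E]

lemma lp_two_hasSum_norm_sq (f : lp (fun _ : ι => E) 2) :
    HasSum (fun i => ‖f i‖ ^ 2) (‖f‖ ^ 2) := by
  simpa using lp.hasSum_norm (p := 2) (by norm_num) f

lemma memℓp_two_comp_equiv (σ : ι ≃ ι) (f : lp (fun _ : ι => E) 2) :
    Memℓp (fun i => f (σ i)) 2 := by
  apply memℓp_gen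
  simpa [Function.comp_def] using
    (σ.summable_iff (f := fun i => ‖f i‖ ^ 2)).2 (lp_two_hasSum_norm_sq f).summable

lemma lp_two_norm_sq_le (f : lp (fun _ : ι => E) 2) (s : Finset ι) (C : ℝ)
    (hs : ∀ i ∉ s, f i = 0) (hC : ∀ i ∈ s, ‖f i‖ ≤ C) : ‖f‖ ^ 2 ≤ s.card * C ^ 2 := by
  have h : HasSum (fun i => ‖f i‖ ^ 2) (∑ i ∈ s, ‖f i‖ ^ 2) :=
    hasSum_sum_of_ne_finset_zero fun i hi => by simp [hs i hi]
  rw [(lp_two_hasSum_norm_sq f).unique h, ← nsmul_eq_mul]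
  exact Finset.sum_le_card_nsmul _ _ _ fun i hi => pow_le_pow_left₀ (norm_nonneg _) (hC i hi) 2

lemma le_lp_two_norm_sq (f : lp (fun _ : ι => E) 2) (s : Finset ι) (C : ℝ) (hC0 : 0 ≤ C)
    (hC : ∀ i ∈ s, C ≤ ‖f i‖) : s.card * C ^ 2 ≤ ‖f‖ ^ 2 := by
  refine le_trans ?_ (sum_le_hasSum s (fun i _ => by positivity) (lp_two_hasSum_norm_sq f))
  rw [← nsmul_eq_mul]
  exact Finset.card_nsmul_le_sum _ _ _ fun i hi => pow_le_pow_left₀ hC0 (hC i hi) 2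

variable [NormedSpace ℝ E]

/-- The operator on `ℓ²` induced by a permutation of the index set. -/
noncomputable def lpReindex (σ : ι ≃ ι) : Module.End ℝ (lp (fun _ : ι => E) 2) where
  toFun f := ⟨fun i => f (σ i), memℓp_two_comp_equiv σ f⟩
  map_add' _ _ := rfl
  map_smul' _ _ := rfl

@[simp]
lemma lpReindex_apply (σ : ι ≃ ι) (f : lp (fun _ : ι => E) 2) (i : ι) :
    lpReindex σ f i = f (σ i) := rfl

lemma norm_lpReindex (σ : ι ≃ ι) (f : lp (fun _ : ι => E) 2) : ‖lpReindex σ f‖ = ‖f‖ := by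
  have h1 := lp_two_hasSum_norm_sq (lpReindex σ f)
  have h2 := (σ.hasSum_iff (f := fun i => ‖f i‖ ^ 2)).2 (lp_two_hasSum_norm_sq f)
  exact (pow_left_inj₀ (norm_nonneg _) (norm_nonneg _) two_ne_zero).1 (h1.unique h2)

lemma lpReindex_pow_apply (σ : ι ≃ ι) (n : ℕ) (f : lp (fun _ : ι => E) 2) (i : ι) :
    (lpReindex σ ^ n) f i = f ((σ ^ n) i) := by
  induction n generalizing i with
  | zero => simp
  | succ n ih => rw [pow_succ', Module.End.mul_apply, lpReindex_apply, ih, pow_succ,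
      Equiv.Perm.mul_apply]

end Translations

section Cutoff

/-- The piecewise linear function equal to `1` on `[-1, 1]` and to `0` outside `[-2, 2]`. -/
noncomputable def bump (u : ℝ) : ℝ := max 0 (min 1 (2 - |u|))

lemma bump_nonneg (u : ℝ) : 0 ≤ bump u := le_max_left _ _

lemma bump_le_one (u : ℝ) : bump u ≤ 1 := max_le zero_le_one (min_le_left _ _)

lemma bump_eq_one {u : ℝ} (h : |u| ≤ 1) : bump u = 1 := by
  rw [bump, min_eq_left (by linarith)]; norm_num

lemma bump_eq_zero {u : ℝ} (h : 2 ≤ |u|) : bump u = 0 :=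
  max_eq_left ((min_le_right _ _).trans (by linarith))

lemma abs_bump_sub_le (u v : ℝ) : |bump u - bump v| ≤ |u - v| := by
  have h := abs_max_sub_max_le_max (0 : ℝ) (min 1 (2 - |u|)) 0 (min 1 (2 - |v|))
  rw [sub_self (0 : ℝ), abs_zero, max_eq_right (abs_nonneg (min 1 (2 - |u|) - _))] at h
  refine h.trans ?_
  calc |min 1 (2 - |u|) - min 1 (2 - |v|)| ≤ max |(1 : ℝ) - 1| |2 - |u| - (2 - |v|)| :=
        abs_min_sub_min_le_max _ _ _ _
    _ ≤ |u - v| := by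
      refine max_le (by simp) ?_
      rw [sub_sub_sub_cancel_left, abs_sub_comm u v]
      exact abs_abs_sub_abs_le v u

/-- A cutoff function on the discrete Heisenberg group, adapted to the box of size `R`. -/
noncomputable def heisBump (R : ℕ) (h : ℤ × ℤ × ℤ) : ℝ :=
  bump (h.1 / R) * bump (h.2.1 / R) * bump (h.2.2 / (R * R))

lemma heisBump_nonneg (R : ℕ) (h : ℤ × ℤ × ℤ) : 0 ≤ heisBump R h :=
  mul_nonneg (mul_nonneg (bump_nonneg _) (bump_nonneg _)) (bump_nonneg _)

lemma heisBump_le_one (R : ℕ) (h : ℤ × ℤ × ℤ) : heisBump R h ≤ 1 :=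
  mul_le_one₀ (mul_le_one₀ (bump_le_one _) (bump_nonneg _) (bump_le_one _)) (bump_nonneg _)
    (bump_le_one _)

lemma heisBump_eq_one {R : ℕ} (hR : 1 ≤ R) {h : ℤ × ℤ × ℤ} (h1 : |h.1| ≤ R) (h2 : |h.2.1| ≤ R)
    (h3 : |h.2.2| ≤ R * R) : heisBump R h = 1 := by
  have hR0 : (0 : ℝ) < R := by exact_mod_cast hR
  have e1 : |(h.1 : ℝ)| ≤ R := by exact_mod_cast h1
  have e2 : |(h.2.1 : ℝ)| ≤ R := by exact_mod_cast h2
  have e3 : |(h.2.2 : ℝ)| ≤ R * R := by exact_mod_cast h3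
  have key : ∀ (z : ℤ) (S : ℝ), 0 < S → |(z : ℝ)| ≤ S → bump (z / S) = 1 := by
    intro z S hS hz
    apply bump_eq_one
    rw [abs_div, abs_of_pos hS]
    exact (div_le_one hS).2 hz
  rw [heisBump, key _ _ hR0 e1, key _ _ hR0 e2, key _ _ (by positivity) e3]
  norm_num

lemma heisBump_eq_zero {R : ℕ} (hR : 1 ≤ R) {h : ℤ × ℤ × ℤ}
    (H : 2 * R ≤ |h.1| ∨ 2 * R ≤ |h.2.1| ∨ 2 * (R * R) ≤ |h.2.2|) : heisBump R h = 0 := by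
  have hR0 : (0 : ℝ) < R := by exact_mod_cast hR
  have key : ∀ (z : ℤ) (S : ℝ), 0 < S → 2 * S ≤ |(z : ℝ)| → bump (z / S) = 0 := by
    intro z S hS hz
    apply bump_eq_zero
    rw [abs_div, abs_of_pos hS]
    exact (le_div_iff₀ hS).2 hz
  rcases H with H | H | H
  · rw [heisBump, key _ _ hR0 (by exact_mod_cast H)]; simp
  · rw [heisBump, key h.2.1 _ hR0 (by exact_mod_cast H)]; simp
  · rw [heisBump, key h.2.2 (R * R) (by positivity) (by exact_mod_cast H)]; simp

lemma abs_heisBump_x_sub_le {R : ℕ} (hR : 1 ≤ R) (a b t : ℤ) :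
    |heisBump R (a + 1, b, t) - heisBump R (a, b, t)| ≤ 1 / R := by
  have hR0 : (0 : ℝ) < R := by exact_mod_cast hR
  have h1 := abs_bump_sub_le (((a + 1 : ℤ) : ℝ) / R) (a / R)
  have e : ((a + 1 : ℤ) : ℝ) / R - a / R = 1 / R := by push_cast; ring
  rw [e, abs_of_pos (by positivity : (0 : ℝ) < 1 / R)] at h1
  simp only [heisBump]
  rw [mul_assoc, mul_assoc, ← sub_mul, abs_mul]
  refine (mul_le_of_le_one_right (abs_nonneg _) ?_).trans h1
  rw [abs_of_nonneg (mul_nonneg (bump_nonneg _) (bump_nonneg _))]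
  exact mul_le_one₀ (bump_le_one _) (bump_nonneg _) (bump_le_one _)

lemma abs_heisBump_y_sub_le {R : ℕ} (hR : 1 ≤ R) (a b t : ℤ) :
    |heisBump R (a, b + 1, t + a) - heisBump R (a, b, t)| ≤ 3 / R := by
  have hR0 : (0 : ℝ) < R := by exact_mod_cast hR
  by_cases ha : 2 * (R : ℤ) ≤ |a|
  · rw [heisBump_eq_zero hR (Or.inl ha), heisBump_eq_zero hR (Or.inl ha), sub_zero, abs_zero]
    positivity
  · have ha' : |(a : ℝ)| ≤ 2 * R := by exact_mod_cast (not_le.1 ha).le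
    have h1 := abs_bump_sub_le (((b + 1 : ℤ) : ℝ) / R) (b / R)
    have h2 := abs_bump_sub_le (((t + a : ℤ) : ℝ) / (R * R)) (t / (R * R))
    have e1 : ((b + 1 : ℤ) : ℝ) / R - b / R = 1 / R := by push_cast; ring
    have e2 : ((t + a : ℤ) : ℝ) / (R * R) - t / (R * R) = a / (R * R) := by push_cast; ring
    rw [e1, abs_of_pos (by positivity : (0 : ℝ) < 1 / R)] at h1
    rw [e2, abs_div, abs_of_pos (by positivity : (0 : ℝ) < R * R)] at h2
    have h3 : |(a : ℝ)| / (R * R) ≤ 2 / R := by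
      rw [div_le_div_iff₀ (by positivity) hR0]; nlinarith
    simp only [heisBump]
    set A := bump ((a : ℝ) / R)
    set B := bump ((b : ℝ) / R)
    set B' := bump (((b + 1 : ℤ) : ℝ) / R)
    set T := bump ((t : ℝ) / (R * R))
    set T' := bump (((t + a : ℤ) : ℝ) / (R * R))
    have e : A * B' * T' - A * B * T = (A * T') * (B' - B) + (A * B) * (T' - T) := by ring
    have k : ∀ u v w : ℝ, |bump u * bump v * w| ≤ |w| := by
      intro u v w
      rw [abs_mul, abs_of_nonneg (mul_nonneg (bump_nonneg _) (bump_nonneg _))]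
      exact mul_le_of_le_one_left (abs_nonneg _)
        (mul_le_one₀ (bump_le_one _) (bump_nonneg _) (bump_le_one _))
    rw [e]
    refine (abs_add_le _ _).trans ((add_le_add ((k _ _ _).trans h1)
      ((k _ _ _).trans (h2.trans h3))).trans (le_of_eq (by ring)))

end Cutoff

section NonEmbedding

/-- Right multiplication by `(1, 0, 0)` in the discrete Heisenberg group. -/
def heisShiftX : ℤ × ℤ × ℤ ≃ ℤ × ℤ × ℤ where
  toFun h := (h.1 + 1, h.2.1, h.2.2)
  invFun h := (h.1 - 1, h.2.1, h.2.2)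
  left_inv h := by simp
  right_inv h := by simp

/-- Right multiplication by `(0, 1, 0)` in the discrete Heisenberg group. -/
def heisShiftY : ℤ × ℤ × ℤ ≃ ℤ × ℤ × ℤ where
  toFun h := (h.1, h.2.1 + 1, h.2.2 + h.1)
  invFun h := (h.1, h.2.1 - 1, h.2.2 - h.1)
  left_inv h := by simp
  right_inv h := by simp

/-- Right multiplication by `(0, 0, 1)` in the discrete Heisenberg group. -/
def heisShiftZ : ℤ × ℤ × ℤ ≃ ℤ × ℤ × ℤ where
  toFun h := (h.1, h.2.1, h.2.2 + 1)
  invFun h := (h.1, h.2.1, h.2.2 - 1)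
  left_inv h := by simp
  right_inv h := by simp

lemma heisShiftZ_pow_apply (n : ℕ) (h : ℤ × ℤ × ℤ) :
    (heisShiftZ ^ n) h = (h.1, h.2.1, h.2.2 + n) := by
  induction n with
  | zero => simp
  | succ n ih =>
    rw [pow_succ', Equiv.Perm.mul_apply, ih]
    simp [heisShiftZ, add_assoc]

variable {E : Type*} [NormedAddCommGroup E] [InnerProductSpace ℝ E]

lemma heisIsometries_lpReindex :
    HeisIsometries (lpReindex (E := E) heisShiftX) (lpReindex heisShiftY)
      (lpReindex heisShiftZ) where
  norm_x := norm_lpReindex _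
  norm_y := norm_lpReindex _
  norm_z := norm_lpReindex _
  comm_x := LinearMap.ext fun f => by ext h; simp [heisShiftX, heisShiftZ]
  comm_y := LinearMap.ext fun f => by
    ext h; simp [heisShiftY, heisShiftZ, add_right_comm]
  rel := LinearMap.ext fun f => by
    ext h; simp [heisShiftX, heisShiftY, heisShiftZ, add_comm, add_left_comm]

/-- The finite box outside which the cutoff functions and their translates vanish. -/
noncomputable def heisBox (R : ℕ) : Finset (ℤ × ℤ × ℤ) :=
  Finset.Icc (-(3 * R : ℤ)) (3 * R) ×ˢ Finset.Icc (-(3 * R : ℤ)) (3 * R) ×ˢ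
    Finset.Icc (-(9 * (R * R) : ℤ)) (9 * (R * R))

lemma mem_heisBox {R : ℕ} {h : ℤ × ℤ × ℤ} :
    h ∈ heisBox R ↔ |h.1| ≤ 3 * R ∧ |h.2.1| ≤ 3 * R ∧ |h.2.2| ≤ 9 * (R * R) := by
  simp only [heisBox, Finset.mem_product, Finset.mem_Icc, abs_le]

lemma card_heisBox_le {R : ℕ} (hR : 1 ≤ R) : (heisBox R).card ≤ (31 * (R * R)) ^ 2 := by
  have h1 : ((3 * R : ℤ) + 1 - -(3 * R : ℤ)).toNat = 6 * R + 1 := by omega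
  have h2 : ((9 * (R * R) : ℤ) + 1 - -(9 * (R * R) : ℤ)).toNat = 18 * (R * R) + 1 := by
    have : ((9 * (R * R) : ℤ) + 1 - -(9 * (R * R) : ℤ)) = ((18 * (R * R) + 1 : ℕ) : ℤ) := by
      push_cast; ring
    rw [this, Int.toNat_natCast]
  rw [heisBox, Finset.card_product, Finset.card_product, Int.card_Icc, Int.card_Icc, h1, h2]
  have h3 : 6 * R + 1 ≤ 7 * R := by omega
  have h4 : 18 * (R * R) + 1 ≤ 19 * (R * R) := by nlinarith
  calc (6 * R + 1) * ((6 * R + 1) * (18 * (R * R) + 1))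
      ≤ (7 * R) * ((7 * R) * (19 * (R * R))) := by gcongr
    _ ≤ (31 * (R * R)) ^ 2 := by nlinarith [sq_nonneg (R * R)]

lemma heisBump_eq_zero_of_notMem {R : ℕ} (hR : 1 ≤ R) {h : ℤ × ℤ × ℤ} (hh : h ∉ heisBox R) :
    heisBump R h = 0 ∧ heisBump R (heisShiftX h) = 0 ∧ heisBump R (heisShiftY h) = 0 := by
  have hR' : (1 : ℤ) ≤ R := by exact_mod_cast hR
  have hRR : (R : ℤ) ≤ R * R := by nlinarith
  obtain ⟨a, b, t⟩ := h
  have H : 3 * (R : ℤ) < |a| ∨ 3 * (R : ℤ) < |b| ∨ 9 * ((R : ℤ) * R) < |t| := by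
    by_contra! hcon
    exact hh (mem_heisBox.2 hcon)
  have ha := abs_sub_abs_le_abs_sub a (-1)
  have hb := abs_sub_abs_le_abs_sub b (-1)
  have ht := abs_sub_abs_le_abs_sub t (-a)
  simp only [abs_neg, abs_one, sub_neg_eq_add] at ha hb ht
  simp only [heisShiftX, heisShiftY, Equiv.coe_fn_mk]
  refine ⟨heisBump_eq_zero hR ?_, heisBump_eq_zero hR ?_, heisBump_eq_zero hR ?_⟩ <;>
    simp only <;> rcases H with H | H | H <;> omega

lemma norm_smul_sub_smul_le {x y u v : ℝ} {p q : E} (hx : 0 ≤ x) (hx1 : x ≤ 1)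
    (hxy : |x - y| ≤ u) (hu : 0 ≤ u) (hpq : ‖p - q‖ ≤ v) {w : ℝ} (hq : ‖q‖ ≤ w) :
    ‖x • p - y • q‖ ≤ v + u * w := by
  have e : x • p - y • q = x • (p - q) + (x - y) • q := by module
  rw [e]
  refine (norm_add_le _ _).trans (add_le_add ?_ ?_)
  · rw [norm_smul, Real.norm_of_nonneg hx]
    exact (mul_le_of_le_one_left (norm_nonneg _) hx1).trans hpq
  · rw [norm_smul, Real.norm_eq_abs]
    exact mul_le_mul hxy hq (norm_nonneg _) hu

/-- The discrete Heisenberg group does not embed quasi-isometrically in a Hilbert space. -/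
theorem heis_not_embed (g : ℤ × ℤ × ℤ → E) (c C : ℝ) (hc : 0 < c)
    (hx : ∀ a b t, ‖g (a + 1, b, t) - g (a, b, t)‖ ≤ C)
    (hy : ∀ a b t, ‖g (a, b + 1, t + a) - g (a, b, t)‖ ≤ C)
    (hR : ∀ R : ℕ, 1 ≤ R → ∀ a b t : ℤ, |a| ≤ R → |b| ≤ R → |t| ≤ R * R →
      ‖g (a, b, t) - g 0‖ ≤ C * R)
    (hz : ∀ a b t (N : ℕ), c * N - C ≤ ‖g (a, b, t + N * N) - g (a, b, t)‖) : False := by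
  have hC : 0 ≤ C := (norm_nonneg _).trans (hx 0 0 0)
  obtain ⟨p, hp⟩ := exists_nat_gt (49601 * C / c)
  rw [div_lt_iff₀ hc] at hp
  have hp1 : 1 ≤ p := by
    rcases Nat.eq_zero_or_pos p with rfl | h
    · norm_num at hp; linarith
    · exact h
  have hp0 : (1 : ℝ) ≤ p := by exact_mod_cast hp1
  set K := p ^ 3 * 2 ^ (p ^ 18) with hK
  have hK1 : 1 ≤ K := by rw [hK]; exact Nat.one_le_iff_ne_zero.2 (by positivity)
  set R := 2 * K with hRdef
  have hR1 : 1 ≤ R := by omega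
  have hR0 : (0 : ℝ) < R := by exact_mod_cast hR1
  have hmem : Memℓp (fun h => heisBump R h • (g h - g 0)) 2 := by
    refine (memℓp_zero ((heisBox R).finite_toSet.subset fun h hh => ?_)).of_exponent_ge
      bot_le
    by_contra hcon
    exact hh (by simp [(heisBump_eq_zero_of_notMem hR1 hcon).1])
  let ξ : lp (fun _ : ℤ × ℤ × ℤ => E) 2 := ⟨_, hmem⟩
  have hξ : ∀ h, ξ h = heisBump R h • (g h - g 0) := fun h => rfl
  obtain ⟨j, hj, hsc⟩ := heisIsometries_lpReindex.exists_scale ξ p hp1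
  set N := p ^ 3 * 2 ^ j with hN
  have hNr : (p : ℝ) ^ 3 * 2 ^ j = N := by push_cast [hN]; ring
  rw [hNr] at hsc
  have hNK : N ≤ K := Nat.mul_le_mul_left _ (Nat.pow_le_pow_right (by norm_num) hj.le)
  have hpN : (p : ℝ) ≤ N := by
    rw [← hNr]
    have : (1 : ℝ) ≤ 2 ^ j := one_le_pow₀ (by norm_num)
    nlinarith [pow_le_pow_right₀ hp0 (by norm_num : 1 ≤ 3)]
  have hcN : 0 ≤ c * N - C := by nlinarith
  have hgR : ∀ h ∈ heisBox R, ‖g h - g 0‖ ≤ C * (3 * R) := by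
    rintro ⟨a, b, t⟩ hh
    obtain ⟨h1, h2, h3⟩ := mem_heisBox.1 hh
    have := hR (3 * R) (by omega) a b t (by push_cast; exact h1) (by push_cast; exact h2)
      (by push_cast; linarith)
    push_cast at this
    exact this
  have upper : ∀ σ : ℤ × ℤ × ℤ ≃ ℤ × ℤ × ℤ,
      (∀ h ∉ heisBox R, heisBump R (σ h) = 0) → (∀ h, ‖g (σ h) - g h‖ ≤ C) →
      (∀ h, |heisBump R (σ h) - heisBump R h| ≤ 3 / R) →
      ‖lpReindex σ ξ - ξ‖ ≤ 31 * (R * R) * (10 * C) := by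
    intro σ hσ hσg hσb
    refine le_of_sq_le_sq ?_ (by positivity)
    refine (lp_two_norm_sq_le _ (heisBox R) (10 * C) ?_ ?_).trans ?_
    · intro h hh
      rw [lp.coeFn_sub, Pi.sub_apply, lpReindex_apply, hξ, hξ, hσ h hh,
        (heisBump_eq_zero_of_notMem hR1 hh).1]
      simp
    · intro h hh
      rw [lp.coeFn_sub, Pi.sub_apply, lpReindex_apply, hξ, hξ]
      refine (norm_smul_sub_smul_le (heisBump_nonneg _ _) (heisBump_le_one _ _) (hσb h)
        (by positivity) (v := C) (by simpa using hσg h) (hgR h hh)).trans (le_of_eq ?_)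
      field_simp
      ring
    · rw [mul_pow _ (10 * C)]
      refine mul_le_mul_of_nonneg_right ?_ (sq_nonneg _)
      exact_mod_cast card_heisBox_le hR1
  have hX := upper heisShiftX (fun h hh => (heisBump_eq_zero_of_notMem hR1 hh).2.1)
    (fun h => hx _ _ _) (fun h => (abs_heisBump_x_sub_le hR1 _ _ _).trans (by gcongr; norm_num))
  have hY := upper heisShiftY (fun h hh => (heisBump_eq_zero_of_notMem hR1 hh).2.2)
    (fun h => hy _ _ _) (fun h => abs_heisBump_y_sub_le hR1 _ _ _)
  have lower : (K * K : ℝ) * (c * N - C) ≤ ‖(lpReindex heisShiftZ ^ (N * N)) ξ - ξ‖ := by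
    refine le_of_sq_le_sq ?_ (norm_nonneg _)
    refine le_trans (le_of_eq ?_) (le_lp_two_norm_sq _
      (Finset.Ico (0 : ℤ) K ×ˢ Finset.Ico (0 : ℤ) K ×ˢ Finset.Ico (0 : ℤ) (K * K)) _ hcN ?_)
    · simp only [Finset.card_product, Int.card_Ico]
      have : ((K : ℤ) * K - 0).toNat = K * K := by rw [sub_zero, ← Nat.cast_mul, Int.toNat_natCast]
      rw [this]
      simp only [sub_zero, Int.toNat_natCast]
      push_cast
      ring
    · rintro ⟨a, b, t⟩ hh
      simp only [Finset.mem_product, Finset.mem_Ico] at hh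
      obtain ⟨⟨ha, ha'⟩, ⟨hb, hb'⟩, ⟨ht, ht'⟩⟩ := hh
      have hNK' : (N : ℤ) * N ≤ K * K := by exact_mod_cast Nat.mul_le_mul hNK hNK
      have hN0 : (0 : ℤ) ≤ (N : ℤ) * N := by positivity
      have hRR : (R : ℤ) * R = 4 * (K * K) := by push_cast [hRdef]; ring
      have hRK : (R : ℤ) = 2 * K := by push_cast [hRdef]; ring
      rw [lp.coeFn_sub, Pi.sub_apply, lpReindex_pow_apply, hξ, hξ, heisShiftZ_pow_apply,
        heisBump_eq_one hR1, heisBump_eq_one hR1]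
      · simpa using hz a b t N
      all_goals
        simp only [abs_le]
        push_cast
        constructor <;> linarith
  have hfin : (K * K : ℝ) * (c * N - C) ≤ (K * K) * (49600 * C * N / p) := by
    refine lower.trans (hsc.trans ?_)
    calc _ ≤ 20 / (p : ℝ) * N * (31 * (R * R) * (10 * C) + 31 * (R * R) * (10 * C)) := by gcongr
      _ = _ := by push_cast [hRdef]; field_simp; ring
  have hKK : (0 : ℝ) < K * K := by
    have : (0 : ℝ) < K := by exact_mod_cast hK1
    positivity
  have h1 := le_of_mul_le_mul_left hfin hKK
  have h2 : (c * N - C) * p ≤ 49600 * C * N := by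
    rwa [le_div_iff₀ (by linarith)] at h1
  nlinarith

end NonEmbedding

section Reach

variable {X I : Type*} {Q : I → Set X}

/-- `Reach Q k x y` means that `y` is reached from `x` in `k` moves, each inside a member of `Q`. -/
def Reach (Q : I → Set X) : ℕ → X → X → Prop
  | 0, x, y => x = y
  | k + 1, x, y => ∃ z, Reach Q k x z ∧ ∃ i, z ∈ Q i ∧ y ∈ Q i

lemma reach_one_iff {x y : X} : Reach Q 1 x y ↔ ∃ i, x ∈ Q i ∧ y ∈ Q i := by
  simp [Reach]

lemma chainExists_iff_nat {k : ℕ} (hk : 0 < k) {x y : X} :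
    ChainExists Q k x y ↔ ∃ c : ℕ → I, x ∈ Q (c 0) ∧ y ∈ Q (c (k - 1)) ∧
      ∀ l, l + 1 < k → (Q (c l) ∩ Q (c (l + 1))).Nonempty := by
  constructor
  · rintro ⟨_, c, hx, hy, hc⟩
    refine ⟨fun l => if h : l < k then c ⟨l, h⟩ else c ⟨0, hk⟩, ?_, ?_, ?_⟩
    · simpa [hk] using hx
    · simpa [Nat.sub_lt hk Nat.one_pos] using hy
    · intro l hl
      simpa [hl, (Nat.lt_succ_self l).trans hl] using hc l hl
  · rintro ⟨c, hx, hy, hc⟩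
    exact ⟨hk, fun l => c l, hx, hy, hc⟩

lemma chainExists_succ_iff (k : ℕ) (x y : X) :
    ChainExists Q (k + 1) x y ↔ Reach Q (k + 1) x y := by
  induction k generalizing y with
  | zero =>
    rw [zero_add, chainExists_iff_nat one_pos, reach_one_iff]
    constructor
    · rintro ⟨c, hx, hy, -⟩
      exact ⟨c 0, hx, hy⟩
    · rintro ⟨i, hx, hy⟩
      exact ⟨fun _ => i, hx, hy, fun l hl => by omega⟩
  | succ k ih =>
    rw [chainExists_iff_nat (Nat.succ_pos _)]
    constructor
    · rintro ⟨c, hx, hy, hc⟩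
      obtain ⟨z, hz, hz'⟩ := hc k (by omega)
      refine ⟨z, (ih z).1 ?_, c (k + 1), hz', hy⟩
      rw [chainExists_iff_nat (Nat.succ_pos _)]
      exact ⟨c, hx, hz, fun l hl => hc l (by omega)⟩
    · rintro ⟨z, hz, i, hzi, hyi⟩
      obtain ⟨c, hx, hz', hc⟩ := (chainExists_iff_nat (Nat.succ_pos _)).1 ((ih z).2 hz)
      refine ⟨fun l => if l ≤ k then c l else i, ?_, ?_, ?_⟩
      · simpa using hx
      · simpa using hyi
      · intro l hl
        rcases Nat.lt_or_ge l k with h | h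
        · simpa [h.le, h] using hc l (by omega)
        · obtain rfl : l = k := by omega
          simpa using ⟨z, hz', hzi⟩

lemma coveredDist_eq_sInf_reach (x y : X) :
    coveredDist Q x y = ((sInf {k : ℕ | Reach Q k x y} : ℕ) : ℝ) := by
  by_cases h : x = y
  · have h0 : (0 : ℕ) ∈ {k : ℕ | Reach Q k x y} := h
    rw [coveredDist, if_pos h, Nat.sInf_eq_zero.2 (Or.inl h0), Nat.cast_zero]
  · rw [coveredDist, if_neg h]
    congr 3
    ext k
    cases k with
    | zero => exact ⟨fun ⟨h0, _⟩ => absurd h0 (lt_irrefl 0), fun h0 => absurd h0 h⟩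
    | succ k => exact chainExists_succ_iff k x y

lemma Reach.coveredDist_le {k : ℕ} {x y : X} (h : Reach Q k x y) : coveredDist Q x y ≤ k := by
  rw [coveredDist_eq_sInf_reach]
  exact_mod_cast Nat.sInf_le h

lemma exists_coveredDist_eq {x y : X} (h : ∃ k, Reach Q k x y) :
    ∃ k : ℕ, coveredDist Q x y = k ∧ Reach Q k x y :=
  ⟨_, coveredDist_eq_sInf_reach x y, Nat.sInf_mem h⟩

lemma Reach.trans {k l : ℕ} {x y z : X} (h : Reach Q k x y) (h' : Reach Q l y z) :
    Reach Q (k + l) x z := by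
  induction l generalizing z with
  | zero => obtain rfl : y = z := h'; exact h
  | succ l ih =>
    obtain ⟨w, hw, hi⟩ := h'
    exact ⟨w, ih hw, hi⟩

lemma Reach.symm {k : ℕ} {x y : X} (h : Reach Q k x y) : Reach Q k y x := by
  induction k generalizing y with
  | zero => exact Eq.symm h
  | succ k ih =>
    obtain ⟨w, hw, i, hi, hi'⟩ := h
    have h1 : Reach Q 1 y w := reach_one_iff.2 ⟨i, hi', hi⟩
    rw [add_comm]
    exact h1.trans (ih hw)

lemma coveredDist_comm (hQ : ∀ x y : X, ∃ k, Reach Q k x y) (x y : X) :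
    coveredDist Q x y = coveredDist Q y x := by
  obtain ⟨k, hk, hk'⟩ := exists_coveredDist_eq (hQ x y)
  obtain ⟨l, hl, hl'⟩ := exists_coveredDist_eq (hQ y x)
  exact le_antisymm (hl ▸ hl'.symm.coveredDist_le) (hk ▸ hk'.symm.coveredDist_le)

lemma coveredDist_triangle (hQ : ∀ x y : X, ∃ k, Reach Q k x y) (x y z : X) :
    coveredDist Q x z ≤ coveredDist Q x y + coveredDist Q y z := by
  obtain ⟨k, hk, hk'⟩ := exists_coveredDist_eq (hQ x y)
  obtain ⟨l, hl, hl'⟩ := exists_coveredDist_eq (hQ y z)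
  rw [hk, hl]
  exact_mod_cast (hk'.trans hl').coveredDist_le

end Reach

/-- A quasi-isometry between connected covered spaces has a coarse inverse. -/
lemma IsQuasiIsometry.exists_isQIEmbedding {X Z I J : Type*} {Q : I → Set X} {P : J → Set Z}
    (hP : ∀ x y : Z, ∃ k, Reach P k x y)
    {f : X → Z} (hf : IsQuasiIsometry (coveredDist Q) (coveredDist P) f) :
    ∃ g : Z → X, IsQIEmbedding (coveredDist P) (coveredDist Q) g := by
  obtain ⟨⟨L, C, hL, hC, h⟩, M, hM, hnet⟩ := hf
  choose g hg using hnet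
  refine ⟨g, L, (L + 1 / L) * (C + 2 * M), hL, by positivity, fun x y => ?_⟩
  have h1 := (h (g x) (g y)).1
  have h2 := (h (g x) (g y)).2
  have t1 := coveredDist_triangle hP x (f (g x)) y
  have t2 := coveredDist_triangle hP (f (g x)) (f (g y)) y
  have t3 := coveredDist_triangle hP (f (g x)) x (f (g y))
  have t4 := coveredDist_triangle hP x y (f (g y))
  have hx := hg x
  have hy := hg y
  have cx := coveredDist_comm hP x (f (g x))
  have cy := coveredDist_comm hP y (f (g y))
  set D := coveredDist P (f (g x)) (f (g y))
  set d := coveredDist P x y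
  set e := coveredDist Q (g x) (g y)
  have hL' : 0 < 1 / L := by positivity
  have hLL : L * (1 / L) = 1 := by field_simp
  constructor
  · have : d ≤ L * e + C + 2 * M := by linarith
    have := mul_le_mul_of_nonneg_left this hL'.le
    have e1 : 1 / L * (L * e + C + 2 * M) = e + 1 / L * (C + 2 * M) := by
      field_simp
      ring
    have : 0 ≤ L * (C + 2 * M) := by positivity
    nlinarith
  · have : 1 / L * e ≤ d + C + 2 * M := by linarith
    have := mul_le_mul_of_nonneg_left this hL.le
    have e1 : L * (1 / L * e) = e := by field_simp
    have : 0 ≤ 1 / L * (C + 2 * M) := by positivity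
    nlinarith

section HeisenbergMetric

variable {n : ℕ}

/-- The central coordinate of `p⁻¹ * q` in the Heisenberg group. -/
def heisCentral (p q : HeisReal n) : ℝ :=
  q.2.2 - p.2.2 - ∑ i, p.1 i * (q.2.1 i - p.2.1 i)

lemma heisCentral_add (p q r : HeisReal n) :
    heisCentral p r =
      heisCentral p q + heisCentral q r + ∑ i, (q.1 i - p.1 i) * (r.2.1 i - q.2.1 i) := by
  simp only [heisCentral, sub_mul, mul_sub, Finset.sum_sub_distrib]
  ring

lemma abs_sum_mul_le {u v : Fin n → ℝ} {A B : ℝ} (hA : 0 ≤ A) (hu : ∀ i, |u i| ≤ A)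
    (hv : ∀ i, |v i| ≤ B) : |∑ i, u i * v i| ≤ n * (A * B) := by
  refine (Finset.abs_sum_le_sum_abs _ _).trans ?_
  calc _ ≤ ∑ _i : Fin n, A * B := Finset.sum_le_sum fun i _ => by
        rw [abs_mul]; exact mul_le_mul (hu i) (hv i) (abs_nonneg _) hA
    _ = _ := by simp

lemma heisCover_displacement {p q : HeisReal n} {γ : HeisInt n} (hp : p ∈ heisCover n γ)
    (hq : q ∈ heisCover n γ) : (∀ i, |q.1 i - p.1 i| ≤ 1) ∧ (∀ i, |q.2.1 i - p.2.1 i| ≤ 1) ∧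
      |heisCentral p q| ≤ n + 1 := by
  obtain ⟨s, ⟨hs1, hs2, hs3⟩, rfl⟩ := hp
  obtain ⟨t, ⟨ht1, ht2, ht3⟩, rfl⟩ := hq
  have key : ∀ {x y : ℝ}, x ∈ Icc (0 : ℝ) 1 → y ∈ Icc (0 : ℝ) 1 → |y - x| ≤ 1 := by
    rintro x y ⟨h1, h2⟩ ⟨h3, h4⟩
    rw [abs_le]; constructor <;> linarith
  refine ⟨fun i => ?_, fun i => ?_, ?_⟩
  · simpa [heisMul] using key (hs1 i) (ht1 i)
  · simpa [heisMul] using key (hs2 i) (ht2 i)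
  · have e : heisCentral (heisMul (heisEmbed γ) s) (heisMul (heisEmbed γ) t) =
        (t.2.2 - s.2.2) - ∑ i, s.1 i * (t.2.1 i - s.2.1 i) := by
      simp only [heisCentral, heisMul, heisEmbed, Pi.add_apply, add_mul, mul_sub, mul_add,
        Finset.sum_sub_distrib, Finset.sum_add_distrib]
      ring
    rw [e]
    have h1 := key hs3 ht3
    have h2 := abs_sum_mul_le (n := n) (u := s.1) (v := fun i => t.2.1 i - s.2.1 i) zero_le_one
      (fun i => abs_le.2 ⟨by linarith [(hs1 i).1], (hs1 i).2⟩) (fun i => key (hs2 i) (ht2 i))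
    refine (abs_sub _ _).trans ?_
    linarith

lemma Reach.heisCover_displacement {k : ℕ} {p q : HeisReal n} (h : Reach (heisCover n) k p q) :
    (∀ i, |q.1 i - p.1 i| ≤ k) ∧ (∀ i, |q.2.1 i - p.2.1 i| ≤ k) ∧
      |heisCentral p q| ≤ (n + 1) * (k * k) := by
  induction k generalizing q with
  | zero =>
    obtain rfl : p = q := h
    simp [heisCentral]
  | succ k ih =>
    obtain ⟨r, hr, γ, hrγ, hqγ⟩ := h
    obtain ⟨h1, h2, h3⟩ := ih hr
    obtain ⟨h1', h2', h3'⟩ := _root_.heisCover_displacement hrγ hqγ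
    push_cast
    refine ⟨fun i => ?_, fun i => ?_, ?_⟩
    · exact (abs_sub_le _ (r.1 i) _).trans (by linarith [h1 i, h1' i])
    · exact (abs_sub_le _ (r.2.1 i) _).trans (by linarith [h2 i, h2' i])
    · rw [heisCentral_add p r q]
      have h4 := abs_sum_mul_le k.cast_nonneg h1 h2'
      have h5 := abs_add_three (heisCentral p r) (heisCentral r q)
        (∑ i, (r.1 i - p.1 i) * (q.2.1 i - r.2.1 i))
      have := n.cast_nonneg (α := ℝ)
      have := k.cast_nonneg (α := ℝ)
      nlinarith

lemma reach_heisEmbed_mul {a b s t : Fin n → ℤ} {c u : ℤ} (hs : ∀ i, 0 ≤ s i ∧ s i ≤ 1)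
    (ht : ∀ i, 0 ≤ t i ∧ t i ≤ 1) (hu : 0 ≤ u ∧ u ≤ 1) :
    Reach (heisCover n) 1 (heisEmbed (a, b, c))
      (heisEmbed (a + s, b + t, c + u + ∑ i, a i * t i)) := by
  refine reach_one_iff.2 ⟨(a, b, c), ⟨heisEmbed 0, ?_, ?_⟩, ⟨heisEmbed (s, t, u), ?_, ?_⟩⟩
  · simp [heisCube, heisEmbed]
  · ext <;> simp [heisMul, heisEmbed]
  · exact ⟨fun i => ⟨Int.cast_nonneg (hs i).1, by dsimp only [heisEmbed]; exact_mod_cast (hs i).2⟩,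
      fun i => ⟨Int.cast_nonneg (ht i).1, by dsimp only [heisEmbed]; exact_mod_cast (ht i).2⟩,
      ⟨Int.cast_nonneg hu.1, by dsimp only [heisEmbed]; exact_mod_cast hu.2⟩⟩
  · ext <;> simp [heisMul, heisEmbed]

lemma exists_sub_unit {r : ℕ} {s : Fin n → ℤ} (hs : ∀ i, 0 ≤ s i ∧ s i ≤ (r + 1 : ℕ)) :
    ∃ s' : Fin n → ℤ, (∀ i, 0 ≤ s' i ∧ s' i ≤ r) ∧ ∀ i, 0 ≤ (s - s') i ∧ (s - s') i ≤ 1 := by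
  refine ⟨fun i => min (s i) r, fun i => ?_, fun i => ?_⟩
  · have := hs i; dsimp only; omega
  · have := hs i; simp only [Pi.sub_apply]; omega

lemma reach_heisEmbed_x {r : ℕ} {a b s : Fin n → ℤ} {c : ℤ} (hs : ∀ i, 0 ≤ s i ∧ s i ≤ r) :
    Reach (heisCover n) r (heisEmbed (a, b, c)) (heisEmbed (a + s, b, c)) := by
  induction r generalizing s with
  | zero =>
    obtain rfl : s = 0 := funext fun i => by have := hs i; simp only [Pi.zero_apply]; omega
    simp [Reach]
  | succ r ih =>
    obtain ⟨s', h1, h2⟩ := exists_sub_unit hs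
    have h := reach_heisEmbed_mul (a := a + s') (b := b) (c := c) (t := 0) (u := 0) h2 (by simp)
      (by simp)
    have h3 := (ih h1).trans h
    simpa using h3

lemma reach_heisEmbed_y {r : ℕ} {a b t : Fin n → ℤ} {c : ℤ} (ht : ∀ i, 0 ≤ t i ∧ t i ≤ r) :
    Reach (heisCover n) r (heisEmbed (a, b, c)) (heisEmbed (a, b + t, c + ∑ i, a i * t i)) := by
  induction r generalizing t with
  | zero =>
    obtain rfl : t = 0 := funext fun i => by have := ht i; simp only [Pi.zero_apply]; omega
    simp [Reach]
  | succ r ih =>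
    obtain ⟨t', h1, h2⟩ := exists_sub_unit ht
    have h := reach_heisEmbed_mul (a := a) (b := b + t') (c := c + ∑ i, a i * t' i) (s := 0)
      (u := 0) (by simp) h2 (by simp)
    have h3 := (ih h1).trans h
    simpa [mul_sub, Finset.sum_sub_distrib] using h3

lemma reach_heisEmbed_z {r : ℕ} {a b : Fin n → ℤ} {c u : ℤ} (hu : 0 ≤ u ∧ u ≤ r) :
    Reach (heisCover n) r (heisEmbed (a, b, c)) (heisEmbed (a, b, c + u)) := by
  induction r generalizing u with
  | zero =>
    obtain rfl : u = 0 := by omega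
    simp [Reach]
  | succ r ih =>
    have h := reach_heisEmbed_mul (a := a) (b := b) (c := c + min u r) (s := 0) (t := 0)
      (u := u - min u r) (by simp) (by simp) (by omega)
    have h3 := (ih (u := min u r) (by omega)).trans h
    simpa using h3

lemma reach_heisEmbed_x_signed {r : ℕ} {a b s : Fin n → ℤ} {c : ℤ} (hs : ∀ i, |s i| ≤ r) :
    Reach (heisCover n) (r + r) (heisEmbed (a, b, c)) (heisEmbed (a + s, b, c)) := by
  have h1 : ∀ i, 0 ≤ s⁺ i ∧ s⁺ i ≤ r := fun i => by
    have := abs_le.1 (hs i); simp only [Pi.posPart_apply, posPart_def]; omega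
  have h2 : ∀ i, 0 ≤ s⁻ i ∧ s⁻ i ≤ r := fun i => by
    have := abs_le.1 (hs i); simp only [Pi.negPart_apply, negPart_def]; omega
  have h := (reach_heisEmbed_x (a := a + s) (b := b) (c := c) h2).symm
  have e : a + s + s⁻ = a + s⁺ := by
    rw [add_assoc]; congr 1; exact (sub_eq_iff_eq_add.1 (posPart_sub_negPart s)).symm
  rw [e] at h
  exact (reach_heisEmbed_x h1).trans h

lemma reach_heisEmbed_y_signed {r : ℕ} {a b t : Fin n → ℤ} {c : ℤ} (ht : ∀ i, |t i| ≤ r) :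
    Reach (heisCover n) (r + r) (heisEmbed (a, b, c))
      (heisEmbed (a, b + t, c + ∑ i, a i * t i)) := by
  have h1 : ∀ i, 0 ≤ t⁺ i ∧ t⁺ i ≤ r := fun i => by
    have := abs_le.1 (ht i); simp only [Pi.posPart_apply, posPart_def]; omega
  have h2 : ∀ i, 0 ≤ t⁻ i ∧ t⁻ i ≤ r := fun i => by
    have := abs_le.1 (ht i); simp only [Pi.negPart_apply, negPart_def]; omega
  have h := (reach_heisEmbed_y (a := a) (b := b + t) (c := c + ∑ i, a i * t i) h2).symm
  have e0 : t + t⁻ = t⁺ := (sub_eq_iff_eq_add.1 (posPart_sub_negPart t)).symm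
  have e : c + ∑ i, a i * t i + ∑ i, a i * t⁻ i = c + ∑ i, a i * t⁺ i := by
    rw [← e0, add_assoc, ← Finset.sum_add_distrib]
    simp only [Pi.add_apply, mul_add]
  rw [add_assoc b, e0, e] at h
  exact (reach_heisEmbed_y h1).trans h

lemma reach_heisEmbed_z_mul (hn : 1 ≤ n) {r : ℕ} {a b : Fin n → ℤ} {c u v : ℤ} (hu : |u| ≤ r)
    (hv : |v| ≤ r) :
    Reach (heisCover n) (8 * r) (heisEmbed (a, b, c)) (heisEmbed (a, b, c + u * v)) := by
  let i₀ : Fin n := ⟨0, hn⟩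
  have hs : ∀ {w : ℤ}, |w| ≤ r → ∀ i, |(Pi.single i₀ w : Fin n → ℤ) i| ≤ r := by
    intro w hw i
    by_cases h : i = i₀
    · subst h; simpa using hw
    · simp [h]
  have h1 := reach_heisEmbed_x_signed (a := a) (b := b) (c := c) (hs hu)
  have h2 := reach_heisEmbed_y_signed (a := a + Pi.single i₀ u) (b := b) (c := c) (hs hv)
  have h3 := reach_heisEmbed_x_signed (a := a) (b := b + Pi.single i₀ v)
    (c := c + ∑ i, (a + Pi.single i₀ u : Fin n → ℤ) i * (Pi.single i₀ v : Fin n → ℤ) i) (hs hu)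
  have h4 := reach_heisEmbed_y_signed (a := a) (b := b) (c := c + u * v) (hs hv)
  have e : c + ∑ i, (a + Pi.single i₀ u : Fin n → ℤ) i * (Pi.single i₀ v : Fin n → ℤ) i =
      c + u * v + ∑ i, a i * (Pi.single i₀ v : Fin n → ℤ) i := by
    have h5 : ∀ w : Fin n → ℤ, ∑ i, w i * (Pi.single i₀ v : Fin n → ℤ) i = w i₀ * v := by
      intro w
      rw [Finset.sum_eq_single i₀ (fun j _ hj => by simp [hj]) (by simp)]
      simp
    rw [h5, h5]
    simp
    ring
  rw [e] at h2 h3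
  have := ((h1.trans h2).trans h3.symm).trans h4.symm
  convert this using 1
  ring

/-- Integer points of the homogeneous box of size `r` are reached in `O(r)` moves. -/
lemma reach_heisEmbed_zero (hn : 1 ≤ n) {r : ℕ} (hr : 1 ≤ r) {a b : Fin n → ℤ} {c : ℤ}
    (ha : ∀ i, |a i| ≤ r) (hb : ∀ i, |b i| ≤ r) (hc : |c| ≤ r * r) :
    Reach (heisCover n) (13 * r) (heisEmbed 0) (heisEmbed (a, b, c)) := by
  have hr' : (0 : ℤ) < r := by exact_mod_cast hr
  have h1 := reach_heisEmbed_y_signed (a := 0) (b := 0) (c := 0) hb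
  have h2 := reach_heisEmbed_x_signed (a := 0) (b := b) (c := 0) ha
  have hq : |c / (r : ℤ)| ≤ r := by
    have := abs_le.1 hc
    rw [abs_le]
    exact ⟨(Int.le_ediv_iff_mul_le hr').2 (by linarith), Int.ediv_le_of_le_mul hr' this.2⟩
  have h3 := reach_heisEmbed_z_mul hn (a := a) (b := b) (c := 0) hq (v := r) (by simp)
  have h4 := reach_heisEmbed_z (r := r) (a := a) (b := b) (c := c / r * r) (u := c % r)
    ⟨Int.emod_nonneg _ hr'.ne', (Int.emod_lt_of_pos _ hr').le⟩
  rw [Int.ediv_mul_add_emod] at h4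
  simp only [zero_add, Pi.zero_apply, zero_mul, Finset.sum_const_zero] at h1 h2 h3
  have := ((h1.trans h2).trans h3).trans h4
  convert this using 1
  · ring
  · rfl

lemma exists_mem_heisCover (p : HeisReal n) : ∃ γ, p ∈ heisCover n γ := by
  have hf : ∀ x : ℝ, x - ⌊x⌋ ∈ Icc (0 : ℝ) 1 := fun x =>
    ⟨sub_nonneg.2 (Int.floor_le x), by linarith [Int.lt_floor_add_one x]⟩
  set w : ℝ := p.2.2 - ∑ i, (⌊p.1 i⌋ : ℝ) * (p.2.1 i - ⌊p.2.1 i⌋) with hw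
  refine ⟨(fun i => ⌊p.1 i⌋, fun i => ⌊p.2.1 i⌋, ⌊w⌋),
    (fun i => p.1 i - ⌊p.1 i⌋, fun i => p.2.1 i - ⌊p.2.1 i⌋, w - ⌊w⌋),
    ⟨fun i => hf _, fun i => hf _, hf _⟩, ?_⟩
  ext
  · simp [heisMul, heisEmbed]
  · simp [heisMul, heisEmbed]
  · simp [heisMul, heisEmbed, hw]

lemma heisEmbed_mem_heisCover (γ : HeisInt n) : heisEmbed γ ∈ heisCover n γ :=
  ⟨heisEmbed 0, by simp [heisCube, heisEmbed], by ext <;> simp [heisMul, heisEmbed]⟩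

lemma heisCover_connected (hn : 1 ≤ n) (p q : HeisReal n) : ∃ k, Reach (heisCover n) k p q := by
  have key : ∀ p : HeisReal n, ∃ k, Reach (heisCover n) k (heisEmbed 0) p := by
    intro p
    obtain ⟨γ, hγ⟩ := exists_mem_heisCover p
    obtain ⟨a, b, c⟩ := γ
    set r : ℕ := 1 + (∑ i, (a i).natAbs) + (∑ i, (b i).natAbs) + c.natAbs with hr
    have ha : ∀ i, |a i| ≤ r := fun i => by
      have := Finset.single_le_sum (f := fun i => (a i).natAbs) (fun _ _ => Nat.zero_le _)
        (Finset.mem_univ i)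
      rw [Int.abs_eq_natAbs]
      omega
    have hb : ∀ i, |b i| ≤ r := fun i => by
      have := Finset.single_le_sum (f := fun i => (b i).natAbs) (fun _ _ => Nat.zero_le _)
        (Finset.mem_univ i)
      rw [Int.abs_eq_natAbs]
      omega
    have hc : |c| ≤ r := by rw [Int.abs_eq_natAbs]; omega
    have hr1 : (1 : ℤ) ≤ r := by omega
    exact ⟨_, (reach_heisEmbed_zero hn (by omega) ha hb (hc.trans (by nlinarith))).trans
      (reach_one_iff.2 ⟨_, heisEmbed_mem_heisCover _, hγ⟩)⟩
  obtain ⟨k, hk⟩ := key p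
  obtain ⟨l, hl⟩ := key q
  exact ⟨_, hk.symm.trans hl⟩

end HeisenbergMetric

section UniformMetric

variable {k : ℕ}

lemma Reach.uniformCovering_abs_sub_le {l : ℕ} {u v : Fin k → ℝ}
    (h : Reach (uniformCovering k) l u v) (i : Fin k) : |v i - u i| ≤ l := by
  induction l generalizing v with
  | zero =>
    obtain rfl : u = v := h
    simp
  | succ l ih =>
    obtain ⟨w, hw, c, hwc, hvc⟩ := h
    have h1 := ih hw
    have h2 := hwc i
    have h3 := hvc i
    have h4 : |v i - w i| ≤ 1 := abs_le.2 ⟨by linarith, by linarith⟩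
    push_cast
    linarith [abs_sub_le (v i) (w i) (u i)]

lemma reach_uniformCovering_two {u v : Fin k → ℝ} (h : ∀ i, |v i - u i| ≤ 1) :
    Reach (uniformCovering k) 2 u v := by
  have key : ∀ w : Fin k → ℝ, w ∈ uniformCovering k fun i => ⌊w i⌋ := fun w i =>
    ⟨Int.floor_le _, (Int.lt_floor_add_one _).le⟩
  have hfl : ∀ i, ⌊u i⌋ ≤ ⌊v i⌋ + 1 ∧ ⌊v i⌋ ≤ ⌊u i⌋ + 1 := by
    intro i
    have := abs_le.1 (h i)
    rw [← Int.floor_add_one, ← Int.floor_add_one]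
    exact ⟨Int.floor_le_floor (by linarith), Int.floor_le_floor (by linarith)⟩
  refine Reach.trans (k := 1) (l := 1) (y := fun i => ((max ⌊u i⌋ ⌊v i⌋ : ℤ) : ℝ))
    (reach_one_iff.2 ⟨_, key u, fun i => ?_⟩) (reach_one_iff.2 ⟨_, fun i => ?_, key v⟩)
  · exact ⟨by dsimp only; exact_mod_cast le_max_left _ _,
      by dsimp only; exact_mod_cast max_le (lt_add_one _).le (hfl i).2⟩
  · exact ⟨by dsimp only; exact_mod_cast le_max_right _ _,
      by dsimp only; exact_mod_cast max_le (hfl i).1 (lt_add_one _).le⟩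

lemma reach_uniformCovering {u v : Fin k → ℝ} (N : ℕ) (h : ∀ i, |v i - u i| ≤ N) :
    Reach (uniformCovering k) (2 * N) u v := by
  induction N generalizing v with
  | zero =>
    exact funext fun i => by
      have : v i - u i = 0 := by simpa using h i
      linarith
  | succ N ih =>
    have hN : (0 : ℝ) < (N : ℝ) + 1 := by positivity
    have e : ∀ i, (v i - u i) = ((v i - u i) / (N + 1)) * (N + 1) := fun i => by field_simp
    have hd : ∀ i, |(v i - u i) / (N + 1)| ≤ 1 := fun i => by
      rw [abs_div, abs_of_pos hN, div_le_one hN]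
      exact_mod_cast h i
    refine Reach.trans (k := 2 * N) (l := 2) (y := fun i => v i - (v i - u i) / (N + 1))
      (ih fun i => ?_) (reach_uniformCovering_two fun i => ?_)
    · have : v i - (v i - u i) / (N + 1) - u i = ((v i - u i) / (N + 1)) * N := by
        have := e i; linarith
      rw [this, abs_mul, Nat.abs_cast]
      exact mul_le_of_le_one_left (Nat.cast_nonneg _) (hd i)
    · simpa using hd i

lemma exists_nat_abs_sub_le (u v : Fin k → ℝ) :
    ∃ N : ℕ, (∀ i, |v i - u i| ≤ N) ∧ (N : ℝ) ≤ ‖v - u‖ + 1 := by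
  refine ⟨⌈‖v - u‖⌉₊, fun i => ?_, (Nat.ceil_lt_add_one (norm_nonneg _)).le⟩
  exact (norm_le_pi_norm (v - u) i).trans (Nat.le_ceil _)

lemma uniformCovering_connected (u v : Fin k → ℝ) : ∃ l, Reach (uniformCovering k) l u v := by
  obtain ⟨N, hN, -⟩ := exists_nat_abs_sub_le u v
  exact ⟨_, reach_uniformCovering N hN⟩

lemma norm_sub_le_coveredDist_uniform (u v : Fin k → ℝ) :
    ‖v - u‖ ≤ coveredDist (uniformCovering k) u v := by
  obtain ⟨l, hl, hr⟩ := exists_coveredDist_eq (uniformCovering_connected u v)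
  rw [hl]
  exact (pi_norm_le_iff_of_nonneg (Nat.cast_nonneg _)).2 fun i => hr.uniformCovering_abs_sub_le i

lemma coveredDist_uniform_le (u v : Fin k → ℝ) :
    coveredDist (uniformCovering k) u v ≤ 2 * (‖v - u‖ + 1) := by
  obtain ⟨N, hN, hN'⟩ := exists_nat_abs_sub_le u v
  refine (reach_uniformCovering N hN).coveredDist_le.trans ?_
  push_cast
  linarith

end UniformMetric

section Growth

variable {n m : ℕ}

/-- The homogeneous dilation by `D` on integer points. -/
def heisDilate (D : ℕ) (p : HeisInt n) : HeisInt n :=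
  (fun i => D * p.1 i, fun i => D * p.2.1 i, D * D * p.2.2)

/-- The integer point `p⁻¹ * q`. -/
def heisDiff (p q : HeisInt n) : HeisInt n :=
  (q.1 - p.1, q.2.1 - p.2.1, q.2.2 - p.2.2 - ∑ i, p.1 i * (q.2.1 i - p.2.1 i))

lemma heisDiff_injective (p : HeisInt n) : Function.Injective (heisDiff p) := by
  intro q q' h
  obtain ⟨h1, h2, h3⟩ : _ ∧ _ ∧ _ := by simpa only [heisDiff, Prod.mk.injEq] using h
  have h1 := sub_left_injective h1
  have h2 := sub_left_injective h2
  rw [h2] at h3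
  exact Prod.ext h1 (Prod.ext h2 (by linarith))

lemma heisCentral_heisEmbed (p q : HeisInt n) :
    heisCentral (heisEmbed p) (heisEmbed q) = (heisDiff p q).2.2 := by
  simp [heisCentral, heisEmbed, heisDiff]

/-- The integer points of a box in the Heisenberg group. -/
noncomputable def heisIntBox (n : ℕ) (l u : ℤ) (l' u' : ℤ) : Finset (HeisInt n) :=
  (Fintype.piFinset fun _ => Finset.Icc l u) ×ˢ
    (Fintype.piFinset fun _ => Finset.Icc l u) ×ˢ Finset.Icc l' u'

lemma mem_heisIntBox {l u l' u' : ℤ} {p : HeisInt n} :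
    p ∈ heisIntBox n l u l' u' ↔ (∀ i, l ≤ p.1 i ∧ p.1 i ≤ u) ∧ (∀ i, l ≤ p.2.1 i ∧ p.2.1 i ≤ u) ∧
      l' ≤ p.2.2 ∧ p.2.2 ≤ u' := by
  simp [heisIntBox]

lemma card_heisIntBox (l u l' u' : ℤ) :
    (heisIntBox n l u l' u').card =
      (u + 1 - l).toNat ^ n * ((u + 1 - l).toNat ^ n * (u' + 1 - l').toNat) := by
  simp [heisIntBox]

lemma Reach.heisDiff_mem_heisIntBox {k A : ℕ} {p q : HeisInt n}
    (h : Reach (heisCover n) k (heisEmbed p) (heisEmbed q)) (hk : k ≤ A) :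
    heisDiff p q ∈ heisIntBox n (-A) A (-((n + 1) * (A * A) : ℕ)) ((n + 1) * (A * A) : ℕ) := by
  obtain ⟨h1, h2, h3⟩ := h.heisCover_displacement
  rw [heisCentral_heisEmbed] at h3
  have hB : (n + 1) * (k * k) ≤ (n + 1) * (A * A) := by gcongr
  refine mem_heisIntBox.2 ⟨fun i => abs_le.1 ?_, fun i => abs_le.1 ?_, abs_le.1 ?_⟩
  · have : |q.1 i - p.1 i| ≤ k := by
      have := h1 i
      dsimp only [heisEmbed] at this
      exact_mod_cast this
    exact this.trans (by exact_mod_cast hk)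
  · have : |q.2.1 i - p.2.1 i| ≤ k := by
      have := h2 i
      dsimp only [heisEmbed] at this
      exact_mod_cast this
    exact this.trans (by exact_mod_cast hk)
  · have : |(heisDiff p q).2.2| ≤ ((n + 1) * (k * k) : ℕ) := by exact_mod_cast h3
    exact this.trans (by exact_mod_cast hB)

lemma le_of_abs_mul_sub_le {D k : ℕ} {x y : ℤ} (hxy : x ≠ y)
    (h : |(D * y : ℤ) - D * x| ≤ k) : D ≤ k := by
  have h1 : 1 ≤ |y - x| := Int.one_le_abs (sub_ne_zero.2 hxy.symm)
  rw [← mul_sub, abs_mul, Nat.abs_cast] at h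
  have : (D : ℤ) ≤ k := by nlinarith [Int.natCast_nonneg D]
  exact_mod_cast this

lemma le_of_mul_self_le {N k : ℕ} (h : N * N ≤ (n + 1) * (k * k)) : N ≤ (n + 1) * k := by
  refine Nat.mul_self_le_mul_self_iff.1 (h.trans ?_)
  calc (n + 1) * (k * k) ≤ (n + 1) * ((n + 1) * (k * k)) :=
        Nat.le_mul_of_pos_left _ (Nat.succ_pos n)
    _ = _ := by ring

lemma Reach.le_of_heisDilate {D k : ℕ} {p q : HeisInt n} (hpq : p ≠ q)
    (h : Reach (heisCover n) k (heisEmbed (heisDilate D p)) (heisEmbed (heisDilate D q))) :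
    D ≤ (n + 1) * k := by
  obtain ⟨h1, h2, h3⟩ := h.heisCover_displacement
  have h1' : ∀ i, |(D : ℝ) * q.1 i - D * p.1 i| ≤ k := by simpa [heisEmbed, heisDilate] using h1
  have h2' : ∀ i, |(D : ℝ) * q.2.1 i - D * p.2.1 i| ≤ k := by
    simpa [heisEmbed, heisDilate] using h2
  have hk : k ≤ (n + 1) * k := Nat.le_mul_of_pos_left _ (Nat.succ_pos n)
  by_cases e1 : p.1 = q.1
  · by_cases e2 : p.2.1 = q.2.1
    · have e3 : p.2.2 ≠ q.2.2 := fun e3 => hpq (Prod.ext e1 (Prod.ext e2 e3))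
      rw [heisCentral_heisEmbed] at h3
      have h4 : |((D * D : ℕ) * q.2.2 : ℤ) - (D * D : ℕ) * p.2.2| ≤ ((n + 1) * (k * k) : ℕ) := by
        simp only [heisDiff, heisDilate, e2, sub_self, mul_zero, Finset.sum_const_zero,
          sub_zero] at h3
        exact_mod_cast h3
      exact le_of_mul_self_le (le_of_abs_mul_sub_le e3 h4)
    · obtain ⟨i, hi⟩ := Function.ne_iff.1 e2
      exact (le_of_abs_mul_sub_le hi (by exact_mod_cast (h2' i))).trans hk
  · obtain ⟨i, hi⟩ := Function.ne_iff.1 e1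
    exact (le_of_abs_mul_sub_le hi (by exact_mod_cast (h1' i))).trans hk

lemma reach_heisDilate (hn : 1 ≤ n) {D r : ℕ} (hD : 1 ≤ D) (hr : 1 ≤ r) {p : HeisInt n}
    (hp : p ∈ heisIntBox n 1 r 1 (r * r : ℕ)) :
    Reach (heisCover n) (13 * (D * r)) (heisEmbed 0) (heisEmbed (heisDilate D p)) := by
  obtain ⟨h1, h2, h3, h4⟩ := mem_heisIntBox.1 hp
  have key : ∀ {N s : ℕ} {x : ℤ}, 1 ≤ x → x ≤ s → |(N * x : ℤ)| ≤ N * s := by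
    intro N s x h h'
    rw [abs_of_nonneg (by positivity)]
    gcongr
  refine reach_heisEmbed_zero hn (Nat.mul_pos hD hr) (fun i => ?_) (fun i => ?_) ?_
  · exact_mod_cast key (N := D) (h1 i).1 (h1 i).2
  · exact_mod_cast key (N := D) (h2 i).1 (h2 i).2
  · have := key (N := D * D) h3 h4
    push_cast at this ⊢
    linarith

lemma le_of_pow_le_const_mul_pow {K : ℕ}
    (h : ∀ r : ℕ, 1 ≤ r → r ^ (2 * n + 2) ≤ K * r ^ (2 * m + 2)) : n ≤ m := by
  by_contra! hlt
  have h1 := h (K + 1) (by omega)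
  have h2 : (K + 1) ^ (2 * m + 2 + 1) ≤ (K + 1) ^ (2 * n + 2) :=
    Nat.pow_le_pow_right (by omega) (by omega)
  have h3 : 0 < (K + 1) ^ (2 * m + 2) := by positivity
  rw [pow_succ] at h2
  nlinarith

/-- Comparing the growth of balls: a quasi-isometric embedding between Heisenberg groups does not
decrease the dimension. -/
theorem le_of_heis_isQIEmbedding (hn : 1 ≤ n) (hm : 1 ≤ m) {f : HeisReal n → HeisReal m}
    (hf : IsQIEmbedding (coveredDist (heisCover n)) (coveredDist (heisCover m)) f) : n ≤ m := by
  obtain ⟨L, C, hL, hC, h⟩ := hf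
  obtain ⟨D, hD⟩ := exists_nat_gt (((n + 1 : ℕ) : ℝ) * (L * (C + 1)))
  have hD1 : 1 ≤ D := by
    have : (0 : ℝ) < D := lt_of_le_of_lt (by positivity) hD
    exact_mod_cast this
  choose γ hγ using exists_mem_heisCover (n := m)
  obtain ⟨K, hK⟩ := exists_nat_ge (L * (13 * D) + C)
  set o := γ (f (heisEmbed 0)) with ho
  let F : HeisInt n → HeisInt m := fun p => heisDiff o (γ (f (heisEmbed (heisDilate D p))))
  have hinj : Function.Injective F := by
    intro p q hpq
    by_contra hne
    have hcell := heisDiff_injective o hpq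
    set x := heisEmbed (heisDilate D p)
    set y := heisEmbed (heisDilate D q)
    have h1 : coveredDist (heisCover m) (f x) (f y) ≤ (1 : ℕ) :=
      (reach_one_iff.2 ⟨_, hγ (f x), hcell ▸ hγ (f y)⟩).coveredDist_le
    obtain ⟨k, hk, hk'⟩ := exists_coveredDist_eq (heisCover_connected hn x y)
    have h2 : D ≤ (n + 1) * k := hk'.le_of_heisDilate hne
    have h3 := (h x y).1
    rw [hk] at h3
    have h4 : (k : ℝ) ≤ L * (C + 1) := by
      rw [Nat.cast_one] at h1
      have : 1 / L * k ≤ C + 1 := by linarith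
      rwa [one_div, inv_mul_le_iff₀ hL] at this
    have h5 : (D : ℝ) ≤ ((n + 1 : ℕ) : ℝ) * k := by exact_mod_cast h2
    have h6 := mul_le_mul_of_nonneg_left h4 (Nat.cast_nonneg (α := ℝ) (n + 1))
    linarith
  have hbox : ∀ r : ℕ, 1 ≤ r → ∀ p ∈ heisIntBox n 1 r 1 (r * r : ℕ),
      F p ∈ heisIntBox m (-((K + 2) * r : ℕ)) ((K + 2) * r : ℕ)
        (-((m + 1) * (((K + 2) * r) * ((K + 2) * r)) : ℕ))
        ((m + 1) * (((K + 2) * r) * ((K + 2) * r)) : ℕ) := by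
    intro r hr p hp
    have h1 := (reach_heisDilate hn hD1 hr hp).coveredDist_le
    set x := heisEmbed (heisDilate D p)
    obtain ⟨k, hk, hk'⟩ := exists_coveredDist_eq (heisCover_connected hm (f (heisEmbed 0)) (f x))
    have h2 : k ≤ K * r := by
      have h3 := (h (heisEmbed 0) x).2
      have h4 := mul_le_mul_of_nonneg_left h1 hL.le
      have hr' : (1 : ℝ) ≤ r := by exact_mod_cast hr
      rw [hk] at h3
      push_cast at h4
      have : (k : ℝ) ≤ K * r := by nlinarith
      exact_mod_cast this
    have h3 : Reach (heisCover m) (1 + k + 1) (heisEmbed o) (heisEmbed (γ (f x))) :=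
      ((reach_one_iff.2 ⟨o, heisEmbed_mem_heisCover _, hγ _⟩).trans hk').trans
        (reach_one_iff.2 ⟨_, hγ _, heisEmbed_mem_heisCover _⟩)
    exact h3.heisDiff_mem_heisIntBox (by nlinarith)
  refine le_of_pow_le_const_mul_pow (K := (2 * K + 5) ^ m * ((2 * K + 5) ^ m *
    (2 * ((m + 1) * ((K + 2) * (K + 2))) + 1))) fun r hr => ?_
  have hcard := Finset.card_le_card_of_injOn F (hbox r hr) hinj.injOn
  rw [card_heisIntBox, card_heisIntBox] at hcard
  have e1 : ((r : ℤ) + 1 - 1).toNat = r := by omega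
  have e2 : (((r * r : ℕ) : ℤ) + 1 - 1).toNat = r * r := by omega
  have e3 : ∀ A : ℕ, ((A : ℤ) + 1 - -(A : ℤ)).toNat = 2 * A + 1 := by intro A; omega
  rw [e1, e2, e3, e3] at hcard
  calc r ^ (2 * n + 2) = r ^ n * (r ^ n * (r * r)) := by ring
    _ ≤ _ := hcard
    _ ≤ ((2 * K + 5) * r) ^ m * (((2 * K + 5) * r) ^ m *
        ((2 * ((m + 1) * ((K + 2) * (K + 2))) + 1) * (r * r))) := by
      gcongr
      · nlinarith
      · nlinarith
      · nlinarith [Nat.mul_le_mul hr hr]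
    _ = _ := by rw [mul_pow]; ring

end Growth

/-- A Heisenberg group does not embed quasi-isometrically into a Euclidean space. -/
theorem not_isQIEmbedding_heis_uniform {n k : ℕ} (hn : 1 ≤ n) {f : HeisReal n → (Fin k → ℝ)}
    (hf : IsQIEmbedding (coveredDist (heisCover n)) (coveredDist (uniformCovering k)) f) :
    False := by
  obtain ⟨L, C, hL, hC, h⟩ := hf
  let i₀ : Fin n := ⟨0, hn⟩
  let j : ℤ × ℤ × ℤ → HeisInt n := fun p => (Pi.single i₀ p.1, Pi.single i₀ p.2.1, p.2.2)
  let g : ℤ × ℤ × ℤ → EuclideanSpace ℝ (Fin k) := fun p => WithLp.toLp 2 (f (heisEmbed (j p)))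
  obtain ⟨K, hK0, hK⟩ : ∃ K : ℝ, 0 ≤ K ∧ ∀ u v : Fin k → ℝ,
      ‖(WithLp.toLp 2 u : EuclideanSpace ℝ (Fin k)) - WithLp.toLp 2 v‖ ≤ K * ‖u - v‖ := by
    refine ⟨((Fintype.card (Fin k) : NNReal) ^ (1 / (2 : ENNReal)).toReal : NNReal),
      NNReal.coe_nonneg _, fun u v => ?_⟩
    have := (PiLp.antilipschitzWith_ofLp 2 fun _ : Fin k => ℝ).le_mul_dist
      (WithLp.toLp 2 u) (WithLp.toLp 2 v)
    rwa [dist_eq_norm, dist_eq_norm] at this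
  have hle : ∀ u v : Fin k → ℝ,
      ‖u - v‖ ≤ ‖(WithLp.toLp 2 u : EuclideanSpace ℝ (Fin k)) - WithLp.toLp 2 v‖ := by
    intro u v
    have := (PiLp.lipschitzWith_ofLp 2 fun _ : Fin k => ℝ).dist_le_mul
      (WithLp.toLp 2 u) (WithLp.toLp 2 v)
    rwa [dist_eq_norm, dist_eq_norm, NNReal.coe_one, one_mul] at this
  have hup : ∀ {l : ℕ} {p q}, Reach (heisCover n) l (heisEmbed (j p)) (heisEmbed (j q)) →
      ‖g q - g p‖ ≤ K * (L * l + C) := fun {l p q} hr =>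
    (hK _ _).trans (mul_le_mul_of_nonneg_left ((norm_sub_le_coveredDist_uniform _ _).trans
      ((h _ _).2.trans (by gcongr; exact hr.coveredDist_le))) hK0)
  have hsingle : ∀ {x : ℤ} {r : ℕ}, |x| ≤ r → ∀ i, |(Pi.single i₀ x : Fin n → ℤ) i| ≤ r := by
    intro x r hx i
    by_cases hi : i = i₀
    · subst hi; simpa using hx
    · simp [hi]
  have hunit : ∀ i, 0 ≤ (Pi.single i₀ 1 : Fin n → ℤ) i ∧
      (Pi.single i₀ 1 : Fin n → ℤ) i ≤ (1 : ℕ) := by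
    intro i
    by_cases hi : i = i₀
    · subst hi; simp
    · simp [hi]
  set C' := K * (L * 13 + C) + C / 2 + 1 with hC'
  have hone : K * (L * (1 : ℕ) + C) ≤ C' := by
    have : K * (L * (1 : ℕ) + C) ≤ K * (L * 13 + C) := by gcongr; norm_num
    linarith
  refine heis_not_embed g (1 / (2 * (L * (n + 1)))) C' (by positivity) ?_ ?_ ?_ ?_
  · intro a b t
    refine (hup (l := 1) ?_).trans hone
    have := reach_heisEmbed_x (a := Pi.single i₀ a) (b := Pi.single i₀ b) (c := t) hunit
    rwa [← Pi.single_add] at this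
  · intro a b t
    refine (hup (l := 1) ?_).trans hone
    have := reach_heisEmbed_y (a := Pi.single i₀ a) (b := Pi.single i₀ b) (c := t) hunit
    rw [← Pi.single_add, Finset.sum_eq_single i₀ (fun i _ hi => by simp [hi]) (by simp)] at this
    simpa [j] using this
  · intro R hR a b t ha hb ht
    have hr := reach_heisEmbed_zero hn hR (hsingle ha) (hsingle hb) ht
    have e : j 0 = 0 := by ext <;> simp [j]
    rw [← e] at hr
    refine (hup (q := (a, b, t)) hr).trans ?_
    have hR' : (1 : ℝ) ≤ R := by exact_mod_cast hR
    push_cast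
    calc K * (L * (13 * R) + C) ≤ K * (L * (13 * R) + C * R) := by
          gcongr; exact le_mul_of_one_le_right hC.le hR'
      _ = K * (L * 13 + C) * R := by ring
      _ ≤ C' * R := by gcongr; linarith
  · intro a b t N
    set x := heisEmbed (j (a, b, t)) with hx
    set y := heisEmbed (j (a, b, t + N * N)) with hy
    obtain ⟨l, hl, hl'⟩ := exists_coveredDist_eq (heisCover_connected hn x y)
    have h1 : N ≤ (n + 1) * l := by
      have := hl'.heisCover_displacement.2.2
      rw [heisCentral_heisEmbed] at this
      simp only [heisDiff, j, sub_self, mul_zero, Finset.sum_const_zero, sub_zero,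
        add_sub_cancel_left] at this
      refine le_of_mul_self_le ?_
      rw [abs_of_nonneg (by positivity)] at this
      exact_mod_cast this
    have h2 := (h x y).1
    have h3 := coveredDist_uniform_le (f x) (f y)
    have h4 : ‖f y - f x‖ ≤ ‖g (a, b, t + N * N) - g (a, b, t)‖ := hle _ _
    have h5 : 1 / (2 * (L * (n + 1))) * N ≤ 1 / 2 * (1 / L * l) := by
      have : (N : ℝ) ≤ (n + 1) * l := by exact_mod_cast h1
      calc 1 / (2 * (L * (n + 1))) * N ≤ 1 / (2 * (L * (n + 1))) * ((n + 1) * l) := by gcongr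
        _ = _ := by field_simp
    have h6 : 0 ≤ K * (L * 13 + C) := by positivity
    rw [hl] at h2
    linarith

lemma abs_sub_le_of_mem_starSet {n k : ℕ} {v : HeisInt n} {p : HeisReal n}
    (hp : p ∈ starSet (uniformCoverH n) v k) : |p.2.2 - v.2.2| ≤ k + 1 := by
  have hcell : ∀ {w : HeisInt n} {q : HeisReal n}, q ∈ uniformCoverH n w →
      0 ≤ q.2.2 - w.2.2 ∧ q.2.2 - w.2.2 ≤ 1 := by
    rintro w _ ⟨s, ⟨-, -, hs⟩, rfl⟩
    simpa [heisEmbed] using hs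
  induction k generalizing p with
  | zero =>
    have := hcell hp
    rw [abs_le]
    constructor <;> push_cast <;> linarith
  | succ k ih =>
    simp only [starSet, mem_iUnion] at hp
    obtain ⟨l, ⟨z, hz, hz'⟩, hp⟩ := hp
    have h1 := abs_le.1 (ih hz')
    have h2 := hcell hz
    have h3 := hcell hp
    rw [abs_le]
    push_cast
    constructor <;> linarith

lemma not_almostSubordinate_heisCover_uniformCoverH :
    ¬ AlmostSubordinate (heisCover 1) (uniformCoverH 1) := by
  rintro ⟨k, hk⟩
  obtain ⟨v, hv⟩ := hk (fun _ => 2 * k + 3, 0, 0)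
  have h1 := abs_le.1 (abs_sub_le_of_mem_starSet (hv ⟨(0, 0, 0), by simp [heisCube], rfl⟩))
  have h2 := abs_le.1 (abs_sub_le_of_mem_starSet
    (hv ⟨(0, fun _ => 1, 0), by simp [heisCube], rfl⟩))
  simp [heisMul, heisEmbed] at h1 h2
  linarith

/-- For all `n, m, k ≥ 1`: if `n ≠ m` then `(ℝ^{2n+1}, d_{P_n})` is not
quasi-isometric to `(ℝ^{2m+1}, d_{P_m})`; and for every `k`, `(ℝ^{2n+1}, d_{P_n})` is not
quasi-isometric to `(ℝᵏ, d_U)`. In particular, the Heisenberg covering `P_1` on `ℝ³` is not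
equivalent to the uniform covering `U` on `ℝ³`. -/
theorem statement13 (n m k : ℕ) (hn : 1 ≤ n) (hm : 1 ≤ m) (hk : 1 ≤ k) :
    (n ≠ m → ¬ ∃ f : HeisReal n → HeisReal m,
        IsQuasiIsometry (coveredDist (heisCover n)) (coveredDist (heisCover m)) f) ∧
    (¬ ∃ f : HeisReal n → (Fin k → ℝ),
        IsQuasiIsometry (coveredDist (heisCover n)) (coveredDist (uniformCovering k)) f) ∧
    ¬ EquivalentCoverings (heisCover 1) (uniformCoverH 1) := by
  refine ⟨?_, ?_, fun h => not_almostSubordinate_heisCover_uniformCoverH h.1⟩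
  · rintro hnm ⟨f, hf⟩
    obtain ⟨g, hg⟩ := hf.exists_isQIEmbedding (heisCover_connected hm)
    exact hnm (le_antisymm (le_of_heis_isQIEmbedding hn hm hf.1)
      (le_of_heis_isQIEmbedding hm hn hg))
  · rintro ⟨f, hf⟩
    exact not_isQIEmbedding_heis_uniform hn hf.1
end
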